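/- Let γ: ℝ/L → ℝ³ be a minimal inspection curve with unfolding γ̃: [0, L] → ℝ². Then γ̃ admits a spiral decomposition: there is a collection {U_i} of mutually disjoint open subsets of [0, L] such that each restriction γ̃|cl(U_i) is a strict spiral (after reversing the direction of parameterization if necessary), and |γ̃|' = 0 almost everywhere on [0, L] \ ∪_i cl(U_i). -/

import Mathlib

open Real Set MeasureTheory ENNReal

noncomputable section


noncomputable section

abbrev E3 := EuclideanSpace ℝ (Fin 3)

/-- The lift of a curve `γ : ℝ/L → ℝ³` to `ℝ`, via the quotient map `ℝ → ℝ/L`. -/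
def liftCurve (L : ℝ) (γ : AddCircle L → E3) : ℝ → E3 := fun s => γ s

/-- An inspection curve is a closed rectifiable curve `γ : ℝ/L → ℝ³`, parameterized with
constant unit speed (`1`-Lipschitz with total variation `L` over one period), whose convex
hull contains the unit sphere centered at the origin. -/
def IsInspectionCurve (L : ℝ) (γ : AddCircle L → E3) : Prop :=
  0 < L ∧ Continuous γ ∧ LipschitzWith 1 (liftCurve L γ) ∧
    eVariationOn (liftCurve L γ) (Set.Icc 0 L) = ENNReal.ofReal L ∧
    Metric.sphere (0 : E3) 1 ⊆ convexHull ℝ (Set.range γ)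

/-- A minimal inspection curve is an inspection curve of minimal length. -/
def IsMinInspectionCurve (L : ℝ) (γ : AddCircle L → E3) : Prop :=
  IsInspectionCurve L γ ∧
    ∀ (L' : ℝ) (γ' : AddCircle L' → E3), IsInspectionCurve L' γ' → L ≤ L'

/-- The (almost-everywhere defined) derivative of the radial projection
`γ̄ = γ/|γ| : ℝ → S²` of the lifted curve. -/
def projDeriv (L : ℝ) (γ : AddCircle L → E3) : ℝ → E3 :=
  deriv fun s : ℝ => ‖liftCurve L γ s‖⁻¹ • liftCurve L γ s

/-- The arclength function `θ(t) = ∫₀ᵗ |γ̄'(s)| ds` of the radial projection of `γ`. -/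
def thetaFn (L : ℝ) (γ : AddCircle L → E3) (t : ℝ) : ℝ :=
  ∫ u in (0:ℝ)..t, ‖projDeriv L γ u‖

/-- `γt : [0,L] → ℝ² ≅ ℂ` is the unfolding of `γ : ℝ/L → ℝ³`: for the finitely many times
`0 = t₀ < t₁ < ⋯ < t_m = L` at which `γ` passes through the origin (together with the
distinguished endpoints `0` and `L`), one has
`γt(s) = |γ(s)| · e^{i(θ(s) + (k-1)π)}` for `s ∈ [t_{k-1}, t_k]`. -/
def IsUnfolding (L : ℝ) (γ : AddCircle L → E3) (γt : ℝ → ℂ) : Prop :=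
  ∃ (m : ℕ) (tk : ℕ → ℝ), 0 < m ∧ StrictMonoOn tk (Set.Iic m) ∧
    tk 0 = 0 ∧ tk m = L ∧
    (∀ s ∈ Set.Ioo (0:ℝ) L,
      (liftCurve L γ s = 0 ↔ ∃ k : ℕ, 0 < k ∧ k < m ∧ s = tk k)) ∧
    (∀ k : ℕ, 1 ≤ k → k ≤ m → ∀ s ∈ Set.Icc (tk (k-1)) (tk k),
      γt s = (‖liftCurve L γ s‖ : ℂ) *
        Complex.exp (Complex.I * Complex.ofReal (thetaFn L γ s + ((k : ℝ) - 1) * π)))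

/-- The Euclidean dot product on `ℝ² ≅ ℂ`. -/
def dot2 (x y : ℂ) : ℝ := x.re * y.re + x.im * y.im

/-- `σ` has, at the point `σ t`, a local support line lying above `σ` (relative to the
domain `D`): a line through `σ t` (with normal `n ≠ 0`) such that a neighborhood of `t`
in `D` is mapped into the side of the line containing the origin `o`. -/
def HasLocalSupportLineAbove (σ : ℝ → ℂ) (D : Set ℝ) (t : ℝ) : Prop :=
  ∃ n : ℂ, n ≠ 0 ∧ 0 ≤ dot2 n (σ t) ∧
    ∃ U ∈ nhdsWithin t D, ∀ s ∈ U, dot2 n (σ s) ≤ dot2 n (σ t)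

/-- A planar curve `σ` is locally convex with respect to the origin `o` on `D` if it is
locally one-to-one on `D` and through each of its points there passes a local support
line which lies above `σ` (i.e. with the nearby part of `σ` on the side containing `o`). -/
def LocConvexWrtOrigin (σ : ℝ → ℂ) (D : Set ℝ) : Prop :=
  (∀ t ∈ D, ∃ U ∈ nhdsWithin t D, Set.InjOn σ U) ∧
  (∀ t ∈ D, HasLocalSupportLineAbove σ D t)

/-- A (generalized) spiral: a constant-speed planar curve `σ : [a,b] → ℝ² ≅ ℂ` which is
(i) locally convex with respect to the origin, (ii) has `|σ|` nondecreasing, and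
(iii) satisfies `⟨σ(a), σ'₊(a)⟩ = 0` for the one-sided derivative at `a`. -/
def IsSpiral (σ : ℝ → ℂ) (a b : ℝ) : Prop :=
  a < b ∧ ContinuousOn σ (Set.Icc a b) ∧
  (∃ c : ℝ, ∀ᵐ s ∂(volume.restrict (Set.Icc a b)),
    ∃ v : ℂ, HasDerivAt σ v s ∧ ‖v‖ = c) ∧
  LocConvexWrtOrigin σ (Set.Icc a b) ∧
  MonotoneOn (fun s => ‖σ s‖) (Set.Icc a b) ∧
  ∃ v : ℂ, HasDerivWithinAt σ v (Set.Ici a) a ∧ dot2 (σ a) v = 0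

/-- A strict spiral: a spiral with `|σ|` strictly increasing. -/
def IsStrictSpiral (σ : ℝ → ℂ) (a b : ℝ) : Prop :=
  IsSpiral σ a b ∧ StrictMonoOn (fun s => ‖σ s‖) (Set.Icc a b)

/-- A spiral decomposition of a planar curve `γt : [0,L] → ℝ² ≅ ℂ`: a collection of
mutually disjoint (relatively) open subsets `U i` of `[0,L]` such that each restriction
of `γt` to `cl (U i) = [aᵢ, bᵢ]` is a strict spiral, after reversing direction if
necessary, and `|γt|' = 0` almost everywhere off `⋃ i, cl (U i)`. -/
def IsSpiralDecomp (L : ℝ) (γt : ℝ → ℂ) (ι : Type) (U : ι → Set ℝ) : Prop :=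
  Pairwise (Function.onFun Disjoint U) ∧
  (∀ i, ∃ V : Set ℝ, IsOpen V ∧ U i = V ∩ Set.Icc 0 L) ∧
  (∀ i, ∃ a b : ℝ, closure (U i) = Set.Icc a b ∧
    (IsStrictSpiral γt a b ∨ IsStrictSpiral (fun s => γt (a + b - s)) a b)) ∧
  (∀ᵐ s ∂(volume.restrict (Set.Icc 0 L \ ⋃ i, closure (U i))),
    HasDerivAt (fun u => ‖γt u‖) 0 s)

open scoped RealInnerProductSpace

lemma exists_norm_le_inner_of_sphere_subset {S : Set E3}
    (hS : Metric.sphere (0 : E3) 1 ⊆ convexHull ℝ S) (u : E3) : ∃ x ∈ S, ‖u‖ ≤ ⟪u, x⟫ := by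
  by_contra! hcon
  rcases eq_or_ne u 0 with rfl | hu
  · obtain ⟨e, he⟩ : ∃ e : E3, ‖e‖ = 1 := exists_norm_eq E3 zero_le_one
    obtain ⟨x, hx⟩ := convexHull_nonempty_iff.1 ⟨e, hS (by simpa using he)⟩
    simpa using hcon x hx
  · have hu' : 0 < ‖u‖ := norm_pos_iff.2 hu
    have hsub : convexHull ℝ S ⊆ {x | ⟪u, x⟫ < ‖u‖} :=
      convexHull_min hcon (convex_halfSpace_lt (innerₗ E3 u).isLinear _)
    have hmem : ‖u‖⁻¹ • u ∈ Metric.sphere (0 : E3) 1 := by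
      simp [norm_smul, hu'.ne']
    have h := hsub (hS hmem)
    simp only [mem_ofPred_eq, inner_smul_right, real_inner_self_eq_norm_sq] at h
    have : ‖u‖⁻¹ * ‖u‖ ^ 2 = ‖u‖ := by field_simp
    linarith

lemma sphere_subset_convexHull_of_support {S : Set E3} {r : ℝ} (hr : 1 < r)
    (hS : ∀ u : E3, ∃ x ∈ S, r * ‖u‖ ≤ ⟪u, x⟫) :
    Metric.sphere (0 : E3) 1 ⊆ convexHull ℝ S := by
  have hball : Metric.ball (0 : E3) r ⊆ closure (convexHull ℝ S) := by
    intro y hy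
    by_contra hn
    obtain ⟨f, c, hf, hc⟩ := geometric_hahn_banach_closed_point
      (convex_convexHull ℝ S).closure isClosed_closure hn
    obtain ⟨u, rfl⟩ := (InnerProductSpace.toDual ℝ E3).surjective f
    obtain ⟨x, hx, hxu⟩ := hS u
    have h1 := hf x (subset_closure (subset_convexHull ℝ S hx))
    simp only [InnerProductSpace.toDual_apply_apply] at h1 hc
    have h2 := real_inner_le_norm u y
    have h3 : ‖y‖ < r := by simpa using hy
    nlinarith [norm_nonneg u]
  have haff : affineSpan ℝ S = ⊤ := by
    have hcl : closure (convexHull ℝ S) ⊆ affineSpan ℝ S :=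
      closure_minimal (convexHull_subset_affineSpan S)
        (AffineSubspace.closed_of_finiteDimensional _)
    have htop := Metric.isOpen_ball.affineSpan_eq_top (P := E3)
      (⟨0, Metric.mem_ball_self (by linarith)⟩ : (Metric.ball (0 : E3) r).Nonempty)
    exact top_le_iff.1 (htop ▸ affineSpan_le.2 (hball.trans hcl))
  have hne : (interior (convexHull ℝ S)).Nonempty :=
    interior_convexHull_nonempty_iff_affineSpan_eq_top.2 haff
  intro y hy
  have : y ∈ interior (closure (convexHull ℝ S)) :=
    interior_maximal hball Metric.isOpen_ball (by simp at hy ⊢; linarith)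
  rw [(convex_convexHull ℝ S).interior_closure_eq_interior_of_nonempty_interior hne] at this
  exact interior_subset this

lemma lipschitzOnWith_Icc_union {X : Type*} [PseudoMetricSpace X] {f : ℝ → X} {K : NNReal}
    {a b c : ℝ} (h1 : LipschitzOnWith K f (Icc a b)) (h2 : LipschitzOnWith K f (Icc b c)) :
    LipschitzOnWith K f (Icc a c) := by
  rw [lipschitzOnWith_iff_dist_le_mul] at *
  have key : ∀ x ∈ Icc a c, ∀ y ∈ Icc a c, x ≤ y → dist (f x) (f y) ≤ K * dist x y := by
    intro x hx y hy hxy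
    rcases le_total y b with hyb | hyb
    · exact h1 x ⟨hx.1, hxy.trans hyb⟩ y ⟨hy.1, hyb⟩
    rcases le_total x b with hxb | hxb
    · have e1 := h1 x ⟨hx.1, hxb⟩ b ⟨hx.1.trans hxb, le_rfl⟩
      have e2 := h2 b ⟨le_rfl, hyb.trans hy.2⟩ y ⟨hyb, hy.2⟩
      have e3 := dist_triangle (f x) (f b) (f y)
      rw [Real.dist_eq, abs_of_nonpos (by linarith)] at e1 e2 ⊢
      linarith
    · exact h2 x ⟨hxb, hx.2⟩ y ⟨hyb, hy.2⟩
  intro x hx y hy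
  rcases le_total x y with h | h
  · exact key x hx y hy h
  · rw [dist_comm (f x), dist_comm x]; exact key y hy x hx h

lemma Function.Periodic.lipschitzWith {X : Type*} [PseudoMetricSpace X] {f : ℝ → X} {V : ℝ}
    (hV : 0 < V) {K : NNReal} (hp : Function.Periodic f V) (hf : LipschitzOnWith K f (Icc 0 V)) :
    LipschitzWith K f := by
  have h2 : LipschitzOnWith K f (Icc V (V + V)) := by
    rw [lipschitzOnWith_iff_dist_le_mul] at *
    intro x hx y hy
    have := hf (x - V) ⟨by linarith [hx.1], by linarith [hx.2]⟩ (y - V)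
      ⟨by linarith [hy.1], by linarith [hy.2]⟩
    rwa [hp.sub_eq, hp.sub_eq, dist_sub_right] at this
  have h3 := lipschitzOnWith_Icc_union hf h2
  rw [lipschitzOnWith_iff_dist_le_mul] at h3
  have key : ∀ x y, x ≤ y → dist (f x) (f y) ≤ K * dist x y := by
    intro x y hxy
    have hx := toIcoMod_mem_Ico hV 0 x
    have hy := toIcoMod_mem_Ico hV x y
    have hfx : f (toIcoMod hV 0 x) = f x := hp.sub_zsmul_eq _
    have hfy : f (toIcoMod hV x y - toIcoDiv hV 0 x • V) = f y :=
      (hp.sub_zsmul_eq _).trans (hp.sub_zsmul_eq _)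
    have hn : (0 : ℝ) ≤ toIcoDiv hV x y • V := by
      have h1 : (-1 : ℝ) < toIcoDiv hV x y := by
        have h2 := hy.2
        rw [toIcoMod, zsmul_eq_mul] at h2
        nlinarith
      have h3 : (-1 : ℤ) < toIcoDiv hV x y := by exact_mod_cast h1
      exact zsmul_nonneg hV.le (by omega)
    have hyy : toIcoMod hV x y ≤ y := by rw [toIcoMod]; linarith
    have hxd : toIcoMod hV 0 x = x - toIcoDiv hV 0 x • V := rfl
    simp only [zero_add, mem_Ico] at hx hy
    have := h3 _ ⟨hx.1, by linarith⟩ (toIcoMod hV x y - toIcoDiv hV 0 x • V)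
      ⟨by linarith, by linarith⟩
    rw [hfx, hfy, hxd, dist_sub_right] at this
    refine this.trans ?_
    gcongr
    rw [Real.dist_eq, Real.dist_eq, abs_of_nonpos (by linarith), abs_of_nonpos (by linarith)]
    linarith
  refine LipschitzWith.of_dist_le_mul fun x y => ?_
  rcases le_total x y with h | h
  · exact key x y h
  · rw [dist_comm (f x), dist_comm x]; exact key y x h

lemma exists_isInspectionCurve {g : ℝ → E3} {c d : ℝ} {K : NNReal} (hcd : c ≤ d)
    (hg : LipschitzOnWith K g (Icc c d)) (hper : g c = g d)
    (hsph : Metric.sphere (0 : E3) 1 ⊆ convexHull ℝ (g '' Icc c d)) :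
    ∃ γ : AddCircle (eVariationOn g (Icc c d)).toReal → E3,
      IsInspectionCurve (eVariationOn g (Icc c d)).toReal γ := by
  have hlbv : LocallyBoundedVariationOn g (Icc c d) := hg.locallyBoundedVariationOn
  have hc : c ∈ Icc c d := ⟨le_rfl, hcd⟩
  have hd : d ∈ Icc c d := ⟨hcd, le_rfl⟩
  set v := variationOnFromTo g (Icc c d) c with hv
  set N := naturalParameterization g (Icc c d) c with hN
  have hvd : v d = (eVariationOn g (Icc c d)).toReal := by
    rw [hv, variationOnFromTo.eq_of_le _ _ hcd, inter_self]
  have hvc : v c = 0 := variationOnFromTo.self _ _ _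
  rw [← hvd]
  have hNv : ∀ t ∈ Icc c d, N (v t) = g t := fun t ht =>
    edist_eq_zero.1 (edist_naturalParameterization_eq_zero hlbv hc ht)
  have hmono : MonotoneOn v (Icc c d) := variationOnFromTo.monotoneOn hlbv hc
  have hcont : ContinuousOn v (Icc c d) := by
    have : LipschitzOnWith K v (Icc c d) := by
      refine LipschitzOnWith.of_le_add_mul K fun x hx y hy => ?_
      rcases le_total x y with h | h
      · have := hmono hx hy h
        have : 0 ≤ K * dist x y := by positivity
        linarith
      · have hadd := variationOnFromTo.add hlbv hc hy hx
        rw [variationOnFromTo.eq_of_le _ _ h] at hadd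
        have h1 := hg.comp_eVariationOn_le (g := id) (s := Icc c d ∩ Icc y x)
          (fun t ht => ht.1)
        have h2 : eVariationOn (id : ℝ → ℝ) (Icc c d ∩ Icc y x) ≤ ENNReal.ofReal (x - y) :=
          (eVariationOn.mono _ inter_subset_right).trans (eVariationOn_id_Icc y x).le
        have h3 : eVariationOn g (Icc c d ∩ Icc y x) ≤ ENNReal.ofReal (K * (x - y)) := by
          rw [ENNReal.ofReal_mul K.coe_nonneg, ENNReal.ofReal_coe_nnreal]
          exact h1.trans (by gcongr)
        have h4 := ENNReal.toReal_le_of_le_ofReal (mul_nonneg K.coe_nonneg (by linarith)) h3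
        rw [Real.dist_eq, abs_of_nonneg (by linarith)]
        linarith
    exact this.continuousOn
  have himg : v '' Icc c d = Icc 0 (v d) := by
    apply Subset.antisymm
    · rintro _ ⟨t, ht, rfl⟩
      exact ⟨hvc ▸ hmono hc ht ht.1, hmono ht hd ht.2⟩
    · have := intermediate_value_Icc hcd hcont
      rwa [hvc] at this
  have hus : HasUnitSpeedOn N (Icc 0 (v d)) := himg ▸
    has_unit_speed_naturalParameterization g hlbv hc
  have hV : 0 < v d := by
    by_contra hle
    have h0 : v d = 0 := le_antisymm (not_lt.1 hle) (hvc ▸ hmono hc hd hcd)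
    have hconst : ∀ t ∈ Icc c d, g t = N 0 := by
      intro t ht
      have : v t ∈ Icc 0 (v d) := himg ▸ mem_image_of_mem v ht
      rw [h0, Icc_self, mem_singleton_iff] at this
      rw [← hNv t ht, this]
    obtain ⟨_, ⟨t, ht, rfl⟩, h1⟩ := exists_norm_le_inner_of_sphere_subset hsph (-N 0)
    rw [hconst t ht, inner_neg_left, real_inner_self_eq_norm_sq, norm_neg] at h1
    have h2 : N 0 = 0 := norm_eq_zero.1 (by nlinarith [norm_nonneg (N 0)])
    obtain ⟨e, he⟩ : ∃ e : E3, ‖e‖ = 1 := exists_norm_eq E3 zero_le_one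
    obtain ⟨_, ⟨t, ht, rfl⟩, h1⟩ := exists_norm_le_inner_of_sphere_subset hsph e
    rw [hconst t ht, h2, inner_zero_right, he] at h1
    linarith
  have : Fact (0 < v d) := ⟨hV⟩
  have hNlip : LipschitzOnWith 1 N (Icc 0 (v d)) := by
    intro x hx y hy
    wlog hxy : x ≤ y generalizing x y
    · rw [edist_comm, edist_comm x]; exact this hy hx (le_of_not_ge hxy)
    have h1 := hus hx hy
    have h2 := eVariationOn.edist_le N (s := Icc 0 (v d) ∩ Icc x y) (x := x) (y := y)
      ⟨hx, le_rfl, hxy⟩ ⟨hy, hxy, le_rfl⟩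
    rw [h1] at h2
    refine h2.trans ?_
    rw [edist_dist, Real.dist_eq, abs_of_nonpos (by linarith)]
    simp
  have hNper : N 0 = N (v d) := by rw [hNv d hd, ← hvc, hNv c hc, hper]
  set γ := AddCircle.liftIco (v d) 0 N with hγ
  have hγN : ∀ t ∈ Icc 0 (v d), γ (t : AddCircle (v d)) = N t := by
    intro t ht
    rcases ht.2.eq_or_lt with h | h
    · rw [h, AddCircle.coe_period, ← hNper]
      exact AddCircle.liftIco_coe_apply (a := 0) (x := 0) ⟨le_rfl, by simpa using hV⟩
    · exact AddCircle.liftIco_coe_apply ⟨ht.1, by simpa⟩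
  have heq : EqOn (liftCurve (v d) γ) N (Icc 0 (v d)) := hγN
  refine ⟨γ, hV, AddCircle.liftIco_continuous (by simpa using hNper)
    (by simpa using hNlip.continuousOn), ?_, ?_, ?_⟩
  · refine Function.Periodic.lipschitzWith hV (fun x => ?_) ?_
    · simp [liftCurve]
    · intro x hx y hy
      rw [heq hx, heq hy]; exact hNlip hx hy
  · rw [eVariationOn.congr heq]
    have := hus (x := 0) ⟨le_rfl, hV.le⟩ (y := v d) ⟨hV.le, le_rfl⟩
    simpa using this
  · refine hsph.trans (convexHull_mono ?_)
    rintro _ ⟨t, ht, rfl⟩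
    refine ⟨(v t : AddCircle (v d)), ?_⟩
    rw [hγN (v t) (himg ▸ mem_image_of_mem v ht), hNv t ht]

lemma IsMinInspectionCurve.le_eVariationOn {L : ℝ} {γ : AddCircle L → E3}
    (hγ : IsMinInspectionCurve L γ) {g : ℝ → E3} {c d : ℝ} {K : NNReal} (hcd : c ≤ d)
    (hg : LipschitzOnWith K g (Icc c d)) (hper : g c = g d)
    (hsupp : ∀ u : E3, ∃ t ∈ Icc c d, ‖u‖ ≤ ⟪u, g t⟫) :
    ENNReal.ofReal L ≤ eVariationOn g (Icc c d) := by
  have hbv : eVariationOn g (Icc c d) ≠ ⊤ := by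
    simpa [BoundedVariationOn] using hg.locallyBoundedVariationOn c d ⟨le_rfl, hcd⟩ ⟨hcd, le_rfl⟩
  have key : ∀ r : NNReal, 1 < r → L ≤ r * (eVariationOn g (Icc c d)).toReal := by
    intro r hr
    have hl : LipschitzWith r (fun x : E3 => (r : ℝ) • x) := by
      refine LipschitzWith.of_dist_le_mul fun x y => ?_
      rw [dist_smul₀]; simp
    have hlip : LipschitzOnWith (r * K) (fun t => (r : ℝ) • g t) (Icc c d) :=
      hl.comp_lipschitzOnWith hg
    obtain ⟨γ', h'⟩ := exists_isInspectionCurve hcd hlip (by simp [hper])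
      (sphere_subset_convexHull_of_support (r := r) (by exact_mod_cast hr) (fun u => by
        obtain ⟨t, ht, h⟩ := hsupp u
        refine ⟨_, ⟨t, ht, rfl⟩, ?_⟩
        rw [inner_smul_right]; gcongr))
    refine (hγ.2 _ γ' h').trans ?_
    have := (hl.lipschitzOnWith (s := univ)).comp_eVariationOn_le (g := g) (s := Icc c d)
      (mapsTo_univ _ _)
    have h2 := ENNReal.toReal_mono (ENNReal.mul_ne_top ENNReal.coe_ne_top hbv) this
    rw [ENNReal.toReal_mul] at h2
    exact h2
  refine ENNReal.ofReal_le_of_le_toReal (le_of_forall_pos_le_add fun ε hε => ?_)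
  set V := (eVariationOn g (Icc c d)).toReal
  have hV : 0 ≤ V := ENNReal.toReal_nonneg
  have h := key (Real.toNNReal (1 + ε / (V + 1))) (by
    rw [Real.one_lt_toNNReal, lt_add_iff_pos_right]; positivity)
  have h2 : ε / (V + 1) * V ≤ ε := by
    rw [div_mul_eq_mul_div, div_le_iff₀ (by linarith)]; nlinarith
  rw [Real.coe_toNNReal _ (by positivity)] at h
  linarith

lemma AbsolutelyContinuousOnInterval.le_of_ae_hasDerivAt_nonneg {φ : ℝ → ℝ} {a b : ℝ}
    (hab : a ≤ b) (hφ : AbsolutelyContinuousOnInterval φ a b)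
    (h : ∀ᵐ s, s ∈ Ioo a b → ∃ w, 0 ≤ w ∧ HasDerivAt φ w s) : φ a ≤ φ b := by
  rw [← sub_nonneg, ← hφ.integral_deriv_eq_sub]
  refine intervalIntegral.integral_nonneg_of_ae_restrict hab ?_
  rw [Filter.EventuallyLE, ← restrict_Ioo_eq_restrict_Icc, ae_restrict_iff' measurableSet_Ioo]
  filter_upwards [h] with s hs hsI
  obtain ⟨w, hw, hd⟩ := hs hsI
  simpa [hd.deriv] using hw

lemma eVariationOn_le_of_norm_sub_le {g : ℝ → E3} {Φ : ℝ → ℝ} {a b : ℝ} (hab : a ≤ b)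
    (h : ∀ s ∈ Icc a b, ∀ s' ∈ Icc a b, s ≤ s' → ‖g s' - g s‖ ≤ Φ s' - Φ s) :
    eVariationOn g (Icc a b) ≤ ENNReal.ofReal (Φ b - Φ a) := by
  have hmono : MonotoneOn Φ (Icc a b) := fun s hs s' hs' hss' => by
    linarith [h s hs s' hs' hss', norm_nonneg (g s' - g s)]
  have h1 : eVariationOn g (Icc a b) ≤ eVariationOn Φ (Icc a b) := by
    refine iSup_le fun p => le_trans ?_ (eVariationOn.sum_le (f := Φ) (n := p.1) p.2.2.1 p.2.2.2)
    refine Finset.sum_le_sum fun i _ => ?_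
    have h2 := h _ (p.2.2.2 i) _ (p.2.2.2 (i + 1)) (p.2.2.1 (Nat.le_succ i))
    rw [edist_dist, edist_dist, dist_eq_norm, Real.dist_eq]
    exact ENNReal.ofReal_le_ofReal (h2.trans (le_abs_self _))
  refine h1.trans ?_
  have := hmono.eVariationOn_eq (a := a) (b := b) ⟨le_rfl, hab⟩ ⟨hab, le_rfl⟩
  simpa using this.le

lemma LipschitzOnWith.norm_sub_le_of_ae_hasDerivAt {g : ℝ → E3} {Φ : ℝ → ℝ} {a b : ℝ} {K : NNReal}
    (hab : a ≤ b) (hg : LipschitzOnWith K g (Icc a b)) (hΦ : AbsolutelyContinuousOnInterval Φ a b)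
    (h : ∀ᵐ s, s ∈ Ioo a b → ∃ v w, HasDerivAt g v s ∧ HasDerivAt Φ w s ∧ ‖v‖ ≤ w) :
    ‖g b - g a‖ ≤ Φ b - Φ a := by
  set u := g b - g a with hu
  have hac : AbsolutelyContinuousOnInterval (fun s => ⟪u, g s⟫) a b := by
    have : LipschitzOnWith (‖u‖₊ * K) (fun s => ⟪u, g s⟫) (uIcc a b) := by
      rw [uIcc_of_le hab]
      refine LipschitzOnWith.of_dist_le_mul fun x hx y hy => ?_
      rw [Real.dist_eq, ← inner_sub_right]
      refine (abs_real_inner_le_norm _ _).trans ?_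
      rw [← dist_eq_norm, NNReal.coe_mul, mul_assoc]
      exact mul_le_mul_of_nonneg_left (hg.dist_le_mul x hx y hy) (norm_nonneg u)
    exact this.absolutelyContinuousOnInterval
  have key := ((hΦ.const_mul ‖u‖).sub hac).le_of_ae_hasDerivAt_nonneg hab (by
    filter_upwards [h] with s hs hsI
    obtain ⟨v, w, hv, hw, hvw⟩ := hs hsI
    refine ⟨‖u‖ * w - ⟪u, v⟫, ?_, (hw.const_mul _).sub ?_⟩
    · have := real_inner_le_norm u v
      nlinarith [norm_nonneg u]
    · simpa using (hasDerivAt_const s u).inner ℝ hv)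
  simp only [Pi.sub_apply] at key
  have h2 : ⟪u, g b⟫ - ⟪u, g a⟫ = ‖u‖ ^ 2 := by
    rw [← inner_sub_right, ← hu, real_inner_self_eq_norm_sq]
  by_contra hlt
  push Not at hlt
  have h4 : ‖u‖ * ‖u‖ ≤ ‖u‖ * (Φ b - Φ a) := by nlinarith
  rcases (norm_nonneg u).eq_or_lt with h0 | h0
  · have := AbsolutelyContinuousOnInterval.le_of_ae_hasDerivAt_nonneg hab hΦ (by
      filter_upwards [h] with s hs hsI
      obtain ⟨v, w, hv, hw, hvw⟩ := hs hsI
      exact ⟨w, (norm_nonneg v).trans hvw, hw⟩)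
    linarith
  · nlinarith

lemma LipschitzOnWith.eVariationOn_le_of_ae_hasDerivAt {g : ℝ → E3} {Φ : ℝ → ℝ} {a b : ℝ}
    {K : NNReal} (hab : a ≤ b) (hg : LipschitzOnWith K g (Icc a b))
    (hΦ : AbsolutelyContinuousOnInterval Φ a b)
    (h : ∀ᵐ s, s ∈ Ioo a b → ∃ v w, HasDerivAt g v s ∧ HasDerivAt Φ w s ∧ ‖v‖ ≤ w) :
    eVariationOn g (Icc a b) ≤ ENNReal.ofReal (Φ b - Φ a) := by
  refine eVariationOn_le_of_norm_sub_le hab fun s hs s' hs' hss' => ?_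
  refine LipschitzOnWith.norm_sub_le_of_ae_hasDerivAt hss' (hg.mono (Icc_subset_Icc hs.1 hs'.2))
    (hΦ.mono ?_) ?_
  · rw [uIcc_of_le hss', uIcc_of_le hab]; exact Icc_subset_Icc hs.1 hs'.2
  · filter_upwards [h] with t ht htI using ht ⟨hs.1.trans_lt htI.1, htI.2.trans_le hs'.2⟩

lemma LipschitzOnWith.eVariationOn_Icc_le {g : ℝ → E3} {a b : ℝ} (hab : a ≤ b)
    (hg : LipschitzOnWith 1 g (Icc a b)) :
    eVariationOn g (Icc a b) ≤ ENNReal.ofReal (b - a) := by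
  refine eVariationOn_le_of_norm_sub_le (Φ := id) hab fun s hs s' hs' hss' => ?_
  have := hg.dist_le_mul s' hs' s hs
  rwa [dist_eq_norm, Real.dist_eq, abs_of_nonneg (by linarith), NNReal.coe_one, one_mul] at this

section Minimal

variable {L : ℝ} {γ : AddCircle L → E3}

lemma liftCurve_periodic (L : ℝ) (γ : AddCircle L → E3) :
    Function.Periodic (liftCurve L γ) L := fun x => by simp [liftCurve]

lemma IsMinInspectionCurve.exists_norm_le_inner (hγ : IsMinInspectionCurve L γ) (x : ℝ) (u : E3) :
    ∃ t ∈ Ico x (x + L), ‖u‖ ≤ ⟪u, liftCurve L γ t⟫ := by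
  obtain ⟨_, ⟨p, rfl⟩, hp⟩ := exists_norm_le_inner_of_sphere_subset hγ.1.2.2.2.2 u
  obtain ⟨t, rfl⟩ := QuotientAddGroup.mk_surjective p
  obtain ⟨t', ht', he⟩ := (liftCurve_periodic L γ).exists_mem_Ico hγ.1.1 t x
  exact ⟨t', ht', he ▸ hp⟩

lemma IsMinInspectionCurve.le_eVariationOn_replace (hγ : IsMinInspectionCurve L γ) {g : ℝ → E3}
    {x y : ℝ} {K : NNReal} (hxy : x ≤ y) (hyL : y ≤ x + L) (hg : LipschitzOnWith K g (Icc x y))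
    (hgx : g x = liftCurve L γ x) (hgy : g y = liftCurve L γ y)
    (hsupp : ∀ u, ∀ s ∈ Icc x y, ‖u‖ ≤ ⟪u, liftCurve L γ s⟫ → ∃ s' ∈ Icc x y, ‖u‖ ≤ ⟪u, g s'⟫) :
    ENNReal.ofReal (y - x) ≤ eVariationOn g (Icc x y) := by
  set G := liftCurve L γ with hG
  have hGlip : LipschitzWith 1 G := hγ.1.2.2.1
  set k : ℝ → E3 := fun t => if t ≤ y then g t else G t with hk
  have hk1 : EqOn k g (Icc x y) := fun t ht => if_pos ht.2
  have hk2 : EqOn k G (Icc y (x + L)) := fun t ht => by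
    rcases ht.1.eq_or_lt with h | h
    · rw [← h, hk]; simp [hgy]
    · exact if_neg (not_le.2 h)
  have hl1 : LipschitzOnWith (max K 1) k (Icc x y) := fun s hs t ht => by
    rw [hk1 hs, hk1 ht]; exact (hg.weaken (le_max_left K 1)) hs ht
  have hl2 : LipschitzOnWith (max K 1) k (Icc y (x + L)) := fun s hs t ht => by
    rw [hk2 hs, hk2 ht]; exact (hGlip.weaken (le_max_right K 1)) s t
  have hmain := hγ.le_eVariationOn (hxy.trans hyL) (lipschitzOnWith_Icc_union hl1 hl2)
    (by rw [hk1 ⟨le_rfl, hxy⟩, hk2 ⟨hyL, le_rfl⟩, hgx]; exact (liftCurve_periodic L γ x).symm)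
    (fun u => by
      obtain ⟨t, ht, htu⟩ := hγ.exists_norm_le_inner x u
      rcases le_total t y with h | h
      · obtain ⟨s', hs', h'⟩ := hsupp u t ⟨ht.1, h⟩ htu
        exact ⟨s', ⟨hs'.1, hs'.2.trans hyL⟩, by rwa [hk1 hs']⟩
      · exact ⟨t, ⟨ht.1, ht.2.le⟩, by rwa [hk2 ⟨h, ht.2.le⟩]⟩)
  have hsplit := eVariationOn.Icc_add_Icc k (s := univ) hxy hyL (mem_univ _)
  simp only [univ_inter] at hsplit
  rw [← hsplit, eVariationOn.congr hk1, eVariationOn.congr hk2] at hmain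
  have h3 := (hGlip.lipschitzOnWith (s := Icc y (x + L))).eVariationOn_Icc_le hyL
  have hL : ENNReal.ofReal L = ENNReal.ofReal (y - x) + ENNReal.ofReal (x + L - y) := by
    rw [← ENNReal.ofReal_add (by linarith) (by linarith)]; congr 1; ring
  rw [hL] at hmain
  exact (ENNReal.add_le_add_iff_right ENNReal.ofReal_ne_top).1
    (hmain.trans (add_le_add le_rfl h3))

end Minimal

lemma exists_lipschitzOnWith_smul {G : ℝ → E3} (hG : LipschitzWith 1 G) {lam : ℝ → ℝ}
    {C : NNReal} (hlam : LipschitzWith C lam) (p r : ℝ) :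
    ∃ K, LipschitzOnWith K (fun s => lam s • G s) (Icc p r) := by
  obtain ⟨A, hA⟩ := isCompact_Icc.exists_bound_of_continuousOn (s := Icc p r)
    hlam.continuous.continuousOn
  obtain ⟨B, hB⟩ := isCompact_Icc.exists_bound_of_continuousOn (s := Icc p r)
    hG.continuous.continuousOn
  refine ⟨Real.toNNReal (|A| + C * |B|), LipschitzOnWith.of_dist_le_mul fun s hs t ht => ?_⟩
  rw [Real.coe_toNNReal _ (by positivity), dist_eq_norm]
  have h1 : lam s • G s - lam t • G t = lam s • (G s - G t) + (lam s - lam t) • G t := by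
    module
  have h2 := hG.dist_le_mul s t
  have h3 := hlam.dist_le_mul s t
  rw [dist_eq_norm] at h2 h3
  rw [h1]
  refine (norm_add_le _ _).trans ?_
  rw [norm_smul, norm_smul, add_mul]
  refine add_le_add (mul_le_mul ((hA s hs).trans (le_abs_self A)) (by simpa using h2)
    (norm_nonneg _) (abs_nonneg _)) ?_
  calc _ ≤ (C * dist s t) * |B| :=
        mul_le_mul h3 ((hB t ht).trans (le_abs_self B)) (norm_nonneg _) (by positivity)
    _ = _ := by ring

lemma LipschitzWith.absolutelyContinuousOnInterval_norm_sq {G : ℝ → E3} {K : NNReal}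
    (hG : LipschitzWith K G) (p r : ℝ) :
    AbsolutelyContinuousOnInterval (fun s => ‖G s‖ ^ 2) p r := by
  have h : AbsolutelyContinuousOnInterval (fun s => ‖G s‖) p r :=
    (lipschitzWith_one_norm.comp hG).lipschitzOnWith.absolutelyContinuousOnInterval
  simpa only [sq] using h.fun_mul h

lemma eVariationOn_affine_smul_le {G : ℝ → E3} (hG : LipschitzWith 1 G) {p r ε β e M : ℝ}
    (hpr : p ≤ r) (hε : 0 ≤ ε) (hβ : ∀ s ∈ Icc p r, 0 ≤ β * (s - e))
    (hM : ∀ s ∈ Icc p r, ‖G s‖ ^ 2 ≤ M) :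
    ∃ v, eVariationOn (fun s => (1 + ε * (β * (s - e))) • G s) (Icc p r) ≤ ENNReal.ofReal v ∧
      0 ≤ v ∧
      v = (r + ε * β * ((r - e) ^ 2 + ‖G r‖ ^ 2) / 2 + ε ^ 2 * β ^ 2 * M * r / 2) -
        (p + ε * β * ((p - e) ^ 2 + ‖G p‖ ^ 2) / 2 + ε ^ 2 * β ^ 2 * M * p / 2) := by
  have hlam : LipschitzWith (Real.toNNReal |ε * β|) (fun s => 1 + ε * (β * (s - e))) := by
    refine LipschitzWith.of_dist_le_mul fun s t => ?_
    rw [Real.coe_toNNReal _ (abs_nonneg _), Real.dist_eq, Real.dist_eq, ← abs_mul]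
    apply le_of_eq; congr 1; ring
  obtain ⟨K, hK⟩ := exists_lipschitzOnWith_smul hG hlam p r
  have hpoly : AbsolutelyContinuousOnInterval
      (fun s : ℝ => s + ε * β * (s - e) ^ 2 / 2 + ε ^ 2 * β ^ 2 * M * s / 2) p r :=
    ContDiffOn.absolutelyContinuousOnInterval (ContDiff.contDiffOn (by fun_prop))
  have hΦ := hpoly.add ((hG.absolutelyContinuousOnInterval_norm_sq p r).const_mul (ε * β / 2))
  have hae : ∀ᵐ s, s ∈ Ioo p r → ∃ v w, HasDerivAt (fun s => (1 + ε * (β * (s - e))) • G s) v s ∧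
      HasDerivAt ((fun s : ℝ => s + ε * β * (s - e) ^ 2 / 2 + ε ^ 2 * β ^ 2 * M * s / 2) +
        fun s => ε * β / 2 * ‖G s‖ ^ 2) w s ∧ ‖v‖ ≤ w := by
    filter_upwards [hG.ae_differentiableAt] with s hs hsI
    have hsI' : s ∈ Icc p r := Ioo_subset_Icc_self hsI
    set v := deriv G s
    have hv : HasDerivAt G v s := hs.hasDerivAt
    have hv1 : ‖v‖ ≤ 1 := by simpa using norm_deriv_le_of_lipschitz (x₀ := s) hG
    have hl : HasDerivAt (fun s => 1 + ε * (β * (s - e))) (ε * β) s := by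
      have := ((((hasDerivAt_id s).sub_const e).const_mul β).const_mul ε).const_add 1
      simpa using this
    have hp : HasDerivAt (fun s : ℝ => s + ε * β * (s - e) ^ 2 / 2 + ε ^ 2 * β ^ 2 * M * s / 2)
        (1 + ε * β * (s - e) + ε ^ 2 * β ^ 2 * M / 2) s := by
      have h2 := (((hasDerivAt_id s).sub_const e).pow 2).const_mul (ε * β / 2)
      have h3 := (hasDerivAt_id s).const_mul (ε ^ 2 * β ^ 2 * M / 2)
      have := ((hasDerivAt_id s).add h2).add h3
      refine (this.congr_deriv ?_).congr_of_eventuallyEq (.of_forall fun t => ?_)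
      · simp; ring
      · simp; ring
    refine ⟨_, _, hl.smul hv, hp.add (hv.norm_sq.const_mul _), ?_⟩
    have hb := hβ s hsI'
    have hm := hM s hsI'
    set lam := 1 + ε * (β * (s - e)) with hlamdef
    have hlam1 : 1 ≤ lam := by
      have := mul_nonneg hε hb
      linarith
    set i := ⟪G s, v⟫
    have hexp : ‖lam • v + (ε * β) • G s‖ ^ 2
        = lam ^ 2 * ‖v‖ ^ 2 + 2 * (lam * (ε * β)) * i + (ε * β) ^ 2 * ‖G s‖ ^ 2 := by
      rw [norm_add_sq_real, norm_smul, norm_smul, inner_smul_left, inner_smul_right,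
        mul_pow, mul_pow, Real.norm_eq_abs, Real.norm_eq_abs, sq_abs, sq_abs,
        real_inner_comm]
      simp [i]; ring
    set N := ‖lam • v + (ε * β) • G s‖
    have hN : 0 ≤ N := norm_nonneg _
    have hv2 : ‖v‖ ^ 2 ≤ 1 := by nlinarith [norm_nonneg v]
    have h1 : lam ^ 2 * ‖v‖ ^ 2 ≤ lam ^ 2 := by nlinarith [sq_nonneg lam]
    have h2 : (ε * β) ^ 2 * ‖G s‖ ^ 2 ≤ (ε * β) ^ 2 * M := by gcongr
    have h3 : 0 ≤ (ε * β) ^ 2 * M := le_trans (by positivity) h2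
    have h4 : (ε * β) ^ 2 * M ≤ lam * ((ε * β) ^ 2 * M) := by nlinarith
    have h5 : N ^ 2 ≤ lam ^ 2 + 2 * lam * ((ε * β) * i + (ε * β) ^ 2 * M / 2) := by
      rw [hexp]; nlinarith
    have h6 : N ≤ lam + ((ε * β) * i + (ε * β) ^ 2 * M / 2) := by
      nlinarith [sq_nonneg (N - lam)]
    calc N ≤ _ := h6
      _ = _ := by rw [hlamdef]; ring
  refine ⟨_, hK.eVariationOn_le_of_ae_hasDerivAt hpr hΦ hae,
    (norm_nonneg _).trans (hK.norm_sub_le_of_ae_hasDerivAt hpr hΦ hae), ?_⟩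
  simp only [Pi.add_apply]
  ring

lemma nonneg_of_forall_small_mul_add_sq {A B : ℝ}
    (h : ∀ ε > 0, 0 ≤ ε * A + ε ^ 2 * B) : 0 ≤ A := by
  by_contra! hA
  have hB : 0 < |B| + 1 := by positivity
  have h1 := h (-A / (2 * (|B| + 1))) (div_pos (by linarith) (by positivity))
  set ε := -A / (2 * (|B| + 1)) with hε
  have hε0 : 0 < ε := div_pos (by linarith) (by positivity)
  have h2 : ε * (2 * (|B| + 1)) = -A := by rw [hε]; field_simp
  have h3 : 0 ≤ A + ε * B := by
    by_contra! h4
    nlinarith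
  nlinarith [le_abs_self B]

section Minimal

variable {L : ℝ} {γ : AddCircle L → E3}

lemma IsMinInspectionCurve.concaveOn_norm_sq_sub_sq (hγ : IsMinInspectionCurve L γ) (c : ℝ) :
    ConcaveOn ℝ (Icc c (c + L)) (fun t => ‖liftCurve L γ t‖ ^ 2 - t ^ 2) := by
  set G := liftCurve L γ with hG
  have hGlip : LipschitzWith 1 G := hγ.1.2.2.1
  refine concaveOn_of_slope_anti_adjacent (convex_Icc _ _) fun {x z y} hx hy hxz hzy => ?_
  obtain ⟨B, hB⟩ := isCompact_Icc.exists_bound_of_continuousOn (s := Icc x y)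
    hGlip.continuous.continuousOn
  have hM : ∀ s ∈ Icc x y, ‖G s‖ ^ 2 ≤ B ^ 2 := fun s hs =>
    pow_le_pow_left₀ (norm_nonneg _) (hB s hs) 2
  set M := B ^ 2
  set b₁ := 1 / (z - x) with hb₁
  set b₂ := -(1 / (y - z)) with hb₂
  have hzx : 0 < z - x := by linarith
  have hyz : 0 < y - z := by linarith
  have hb₁' : 0 < b₁ := by positivity
  have hb₂' : b₂ < 0 := by rw [hb₂, neg_lt_zero]; positivity
  have hm₁ : b₁ * (z - x) = 1 := by rw [hb₁]; field_simp
  have hm₂ : b₂ * (z - y) = 1 := by rw [hb₂]; field_simp; ring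
  have key : ∀ ε > 0, 0 ≤ ε * ((y - x) / 2 + b₁ * (‖G z‖ ^ 2 - ‖G x‖ ^ 2) / 2
        + b₂ * (‖G y‖ ^ 2 - ‖G z‖ ^ 2) / 2) +
      ε ^ 2 * (b₁ ^ 2 * M * (z - x) / 2 + b₂ ^ 2 * M * (y - z) / 2) := by
    intro ε hε
    have hl : ∀ b e : ℝ, LipschitzWith (Real.toNNReal |ε * b|)
        (fun s => 1 + ε * (b * (s - e))) := fun b e => by
      refine LipschitzWith.of_dist_le_mul fun s t => ?_
      rw [Real.coe_toNNReal _ (abs_nonneg _), Real.dist_eq, Real.dist_eq, ← abs_mul]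
      apply le_of_eq; congr 1; ring
    obtain ⟨K₁, hK₁⟩ := exists_lipschitzOnWith_smul hGlip (hl b₁ x) x z
    obtain ⟨K₂, hK₂⟩ := exists_lipschitzOnWith_smul hGlip (hl b₂ y) z y
    have hn₁ : ∀ s ∈ Icc x z, 0 ≤ b₁ * (s - x) := fun s hs =>
      mul_nonneg hb₁'.le (by linarith [hs.1])
    have hn₂ : ∀ s ∈ Icc z y, 0 ≤ b₂ * (s - y) := fun s hs =>
      mul_nonneg_of_nonpos_of_nonpos hb₂'.le (by linarith [hs.2])
    set g₁ : ℝ → E3 := fun s => (1 + ε * (b₁ * (s - x))) • G s with hg₁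
    set g₂ : ℝ → E3 := fun s => (1 + ε * (b₂ * (s - y))) • G s with hg₂
    set k : ℝ → E3 := fun t => if t ≤ z then g₁ t else g₂ t with hk
    have hk1 : EqOn k g₁ (Icc x z) := fun t ht => if_pos ht.2
    have hk2 : EqOn k g₂ (Icc z y) := fun t ht => by
      rcases ht.1.eq_or_lt with h | h
      · rw [← h, hk]; simp [hg₁, hg₂, hm₁, hm₂]
      · exact if_neg (not_le.2 h)
    have hl1 : LipschitzOnWith (max K₁ K₂) k (Icc x z) := fun s hs t ht => by
      rw [hk1 hs, hk1 ht]; exact (hK₁.weaken (le_max_left _ _)) hs ht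
    have hl2 : LipschitzOnWith (max K₁ K₂) k (Icc z y) := fun s hs t ht => by
      rw [hk2 hs, hk2 ht]; exact (hK₂.weaken (le_max_right _ _)) hs ht
    have hrep := hγ.le_eVariationOn_replace (hxz.trans hzy).le (by linarith [hx.1, hy.2])
      (lipschitzOnWith_Icc_union hl1 hl2) (by rw [hk1 ⟨le_rfl, hxz.le⟩]; simp [hg₁, hG])
      (by rw [hk2 ⟨hzy.le, le_rfl⟩]; simp [hg₂, hG]) (fun u s hs hu => by
        refine ⟨s, hs, ?_⟩
        have hpos : 0 ≤ ⟪u, G s⟫ := (norm_nonneg u).trans hu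
        rcases le_total s z with h | h
        · rw [hk1 ⟨hs.1, h⟩, hg₁]
          simp only [inner_smul_right]
          nlinarith [mul_nonneg (mul_nonneg hε.le (hn₁ s ⟨hs.1, h⟩)) hpos]
        · rw [hk2 ⟨h, hs.2⟩, hg₂]
          simp only [inner_smul_right]
          nlinarith [mul_nonneg (mul_nonneg hε.le (hn₂ s ⟨h, hs.2⟩)) hpos])
    have hsplit := eVariationOn.Icc_add_Icc k (s := univ) hxz.le hzy.le (mem_univ _)
    simp only [univ_inter] at hsplit
    rw [← hsplit, eVariationOn.congr hk1, eVariationOn.congr hk2] at hrep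
    obtain ⟨v₁, hv₁, hv₁0, hv₁e⟩ := eVariationOn_affine_smul_le hGlip hxz.le hε.le hn₁
      (fun s hs => hM s ⟨hs.1, hs.2.trans hzy.le⟩)
    obtain ⟨v₂, hv₂, hv₂0, hv₂e⟩ := eVariationOn_affine_smul_le hGlip hzy.le hε.le hn₂
      (fun s hs => hM s ⟨hxz.le.trans hs.1, hs.2⟩)
    have htot := hrep.trans (add_le_add hv₁ hv₂)
    rw [← ENNReal.ofReal_add hv₁0 hv₂0, ENNReal.ofReal_le_ofReal_iff (by linarith)] at htot
    have e₁ : ε * b₁ * (z - x) ^ 2 = ε * (z - x) := by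
      linear_combination ε * (z - x) * hm₁
    have e₂ : ε * b₂ * (z - y) ^ 2 = ε * (z - y) := by
      linear_combination ε * (z - y) * hm₂
    rw [hv₁e, hv₂e] at htot
    linear_combination htot + e₁ / 2 - e₂ / 2
  have h := nonneg_of_forall_small_mul_add_sq key
  rw [div_le_div_iff₀ hyz hzx]
  have h' : 0 ≤ (y - x) * (z - x) * (y - z) + (‖G z‖ ^ 2 - ‖G x‖ ^ 2) * (y - z)
      - (‖G y‖ ^ 2 - ‖G z‖ ^ 2) * (z - x) := by
    have h2 := mul_nonneg h (mul_pos hzx hyz).le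
    have hm₂' : b₂ * (y - z) = -1 := by linarith
    have h3 : ((y - x) / 2 + b₁ * (‖G z‖ ^ 2 - ‖G x‖ ^ 2) / 2
        + b₂ * (‖G y‖ ^ 2 - ‖G z‖ ^ 2) / 2) * ((z - x) * (y - z)) * 2 =
      (y - x) * (z - x) * (y - z) + (‖G z‖ ^ 2 - ‖G x‖ ^ 2) * (y - z)
      - (‖G y‖ ^ 2 - ‖G z‖ ^ 2) * (z - x) := by
      linear_combination (‖G z‖ ^ 2 - ‖G x‖ ^ 2) * (y - z) * hm₁ +
        (‖G y‖ ^ 2 - ‖G z‖ ^ 2) * (z - x) * hm₂'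
    linarith
  linear_combination h'

end Minimal

lemma smul_eq_smul_of_norm_add_le {a c : E3} {α β : ℝ} (hα : 0 ≤ α) (hβ : 0 ≤ β) (ha : ‖a‖ ≤ α)
    (hca : ‖c - a‖ ≤ β) (hc : α + β ≤ ‖c‖) : (α + β) • a = α • c := by
  set d := c - a with hd
  have hcd : c = a + d := by rw [hd]; abel
  have h1 : ‖c‖ ^ 2 = ‖a‖ ^ 2 + 2 * ⟪a, d⟫ + ‖d‖ ^ 2 := by rw [hcd, norm_add_sq_real]
  have h2 : ‖β • a - α • d‖ ^ 2 = β ^ 2 * ‖a‖ ^ 2 - 2 * (α * β * ⟪a, d⟫) + α ^ 2 * ‖d‖ ^ 2 := by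
    rw [norm_sub_sq_real, norm_smul, norm_smul, inner_smul_left, inner_smul_right, mul_pow,
      mul_pow, Real.norm_eq_abs, Real.norm_eq_abs, sq_abs, sq_abs]
    simp; ring
  have ha2 : ‖a‖ ^ 2 ≤ α ^ 2 := pow_le_pow_left₀ (norm_nonneg _) ha 2
  have hd2 : ‖d‖ ^ 2 ≤ β ^ 2 := pow_le_pow_left₀ (norm_nonneg _) hca 2
  have hc2 : (α + β) ^ 2 ≤ ‖c‖ ^ 2 := pow_le_pow_left₀ (by positivity) hc 2
  have h3 : ‖β • a - α • d‖ ^ 2 ≤ 0 := by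
    have e1 := mul_nonneg (mul_nonneg hα hβ) (sub_nonneg.2 hc2)
    have e2 := mul_nonneg (mul_nonneg hβ (add_nonneg hα hβ)) (sub_nonneg.2 ha2)
    have e3 := mul_nonneg (mul_nonneg hα (add_nonneg hα hβ)) (sub_nonneg.2 hd2)
    rw [h2]
    have h4 : 2 * ⟪a, d⟫ = ‖c‖ ^ 2 - ‖a‖ ^ 2 - ‖d‖ ^ 2 := by linarith
    have h5 : 2 * (α * β * ⟪a, d⟫) = α * β * (‖c‖ ^ 2 - ‖a‖ ^ 2 - ‖d‖ ^ 2) := by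
      rw [← h4]; ring
    rw [h5]
    linear_combination e1 + e2 + e3
  have h6 : β • a - α • d = 0 := by
    rw [← norm_eq_zero]; exact pow_eq_zero_iff two_ne_zero |>.1 (le_antisymm h3 (sq_nonneg _))
  rw [hcd, smul_add, add_smul, sub_eq_zero.1 h6]

section Minimal

variable {L : ℝ} {γ : AddCircle L → E3}

lemma IsMinInspectionCurve.exists_eq_smul_near_zero (hγ : IsMinInspectionCurve L γ) {t₀ : ℝ}
    (h0 : liftCurve L γ t₀ = 0) :
    ∃ r > 0, ∃ v : E3, ‖v‖ = 1 ∧ ∀ s, |s - t₀| ≤ r → liftCurve L γ s = (s - t₀) • v := by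
  set G := liftCurve L γ with hG
  have hGlip : LipschitzWith 1 G := hγ.1.2.2.1
  have hdist : ∀ s t, s ≤ t → ‖G t - G s‖ ≤ t - s := fun s t hst => by
    have := hGlip.dist_le_mul t s
    rwa [dist_eq_norm, Real.dist_eq, abs_of_nonneg (by linarith), NNReal.coe_one, one_mul] at this
  set r := min (1 / 2) (L / 2) with hr
  have hr0 : 0 < r := lt_min (by norm_num) (half_pos hγ.1.1)
  have hr1 : r ≤ 1 / 2 := min_le_left _ _
  have hr2 : r ≤ L / 2 := min_le_right _ _
  set x := t₀ - r with hx
  set y := t₀ + r with hy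
  set w := (2 * r)⁻¹ • (G y - G x) with hw
  set g : ℝ → E3 := fun s => G x + (s - x) • w with hg
  have hglip : LipschitzWith ‖w‖₊ g := LipschitzWith.of_dist_le_mul fun s t => by
    rw [dist_eq_norm, hg, Real.dist_eq]
    simp only [add_sub_add_left_eq_sub, ← sub_smul, sub_sub_sub_cancel_right]
    rw [norm_smul, mul_comm]; rfl
  have hgn : 2 * r * ‖w‖ = ‖G y - G x‖ := by
    rw [hw, norm_smul, Real.norm_of_nonneg (by positivity)]; field_simp
  have hrep := hγ.le_eVariationOn_replace (g := g) (x := x) (y := y) (by linarith) (by linarith)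
    (hglip.lipschitzOnWith) (by simp [hg, hG]) (by
      have : y - x = 2 * r := by rw [hx, hy]; ring
      simp only [hg, this, hw, smul_smul]
      rw [mul_inv_cancel₀ (by positivity), one_smul]; abel) (fun u s hs hu => by
      rcases eq_or_ne u 0 with rfl | hu0
      · exact ⟨x, ⟨le_rfl, by linarith⟩, by simp⟩
      exfalso
      have h1 := real_inner_le_norm u (G s)
      have h2 : ‖G s‖ ≤ r := by
        rcases le_total s t₀ with h | h
        · have := hdist s t₀ h
          rw [h0, zero_sub, norm_neg] at this
          linarith [hs.1]
        · have := hdist t₀ s h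
          rw [h0, sub_zero] at this
          linarith [hs.2]
      have := norm_pos_iff.2 hu0
      nlinarith)
  have hvar := eVariationOn_le_of_norm_sub_le (g := g) (Φ := fun s => s * ‖w‖)
    (show x ≤ y by linarith) (fun s _ s' _ hss' => by
      simp only [hg, add_sub_add_left_eq_sub, ← sub_smul, sub_sub_sub_cancel_right]
      rw [norm_smul, Real.norm_of_nonneg (by linarith), sub_mul])
  have htot := hrep.trans hvar
  have hxy : y - x = 2 * r := by rw [hx, hy]; ring
  rw [ENNReal.ofReal_le_ofReal_iff (by
    rw [← sub_mul]; exact mul_nonneg (by linarith) (norm_nonneg _)), ← sub_mul, hxy] at htot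
  have hline : ∀ s ∈ Icc x y, G s = G x + (s - x) • w := by
    intro s hs
    have h1 := smul_eq_smul_of_norm_add_le (a := G s - G x) (c := G y - G x) (α := s - x)
      (β := y - s) (by linarith [hs.1]) (by linarith [hs.2]) (hdist x s hs.1)
      (by simpa using hdist s y hs.2) (by linarith)
    have h2 : s - x + (y - s) = 2 * r := by linarith
    rw [h2] at h1
    have h3 : G s - G x = (2 * r)⁻¹ • ((s - x) • (G y - G x)) := by
      rw [← h1, smul_smul, inv_mul_cancel₀ (by positivity), one_smul]
    rw [hw, smul_comm, ← h3]; abel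
  refine ⟨r, hr0, w, ?_, fun s hs => ?_⟩
  · have := hdist x y (by linarith)
    nlinarith
  · rw [abs_le] at hs
    have h1 := hline s ⟨by linarith [hs.1], by linarith [hs.2]⟩
    have h2 := hline t₀ ⟨by linarith, by linarith⟩
    rw [h0] at h2
    rw [h1, eq_neg_of_add_eq_zero_left h2.symm]
    module

lemma IsMinInspectionCurve.ae_norm_deriv_eq_one (hγ : IsMinInspectionCurve L γ) :
    ∀ᵐ s, s ∈ Ioo 0 L → ‖deriv (liftCurve L γ) s‖ = 1 := by
  set G := liftCurve L γ with hG
  have hGlip : LipschitzWith 1 G := hγ.1.2.2.1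
  have hL : 0 < L := hγ.1.1
  have hle : ∀ s, ‖deriv G s‖ ≤ 1 := fun s => by
    simpa using norm_deriv_le_of_lipschitz (x₀ := s) hGlip
  have h_int : IntervalIntegrable (fun s => ‖deriv G s‖) volume 0 L := by
    rw [intervalIntegrable_iff_integrableOn_Ioc_of_le hL.le]
    exact IntegrableOn.of_bound (by simp) (measurable_deriv G).norm.aestronglyMeasurable 1
      (.of_forall fun s => by simpa using hle s)
  have hac := h_int.absolutelyContinuousOnInterval_intervalIntegral (c := 0) left_mem_uIcc
  have hvar := (hGlip.lipschitzOnWith (s := Icc 0 L)).eVariationOn_le_of_ae_hasDerivAt hL.le hac (by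
    filter_upwards [h_int.ae_hasDerivAt_integral, hGlip.ae_differentiableAt] with s h1 h2 hs
    exact ⟨_, _, h2.hasDerivAt, h1 (by rw [uIcc_of_le hL.le]; exact Ioo_subset_Icc_self hs) 0
      left_mem_uIcc, le_rfl⟩)
  rw [hγ.1.2.2.2.1, intervalIntegral.integral_same, sub_zero, ENNReal.ofReal_le_ofReal_iff
    (intervalIntegral.integral_nonneg hL.le fun _ _ => norm_nonneg _)] at hvar
  have hzero : ∫ s in (0 : ℝ)..L, (1 - ‖deriv G s‖) = 0 := by
    apply le_antisymm
    · rw [intervalIntegral.integral_sub (by simp) h_int]; simp; linarith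
    · exact intervalIntegral.integral_nonneg hL.le fun s _ => by linarith [hle s]
  rw [intervalIntegral.integral_eq_zero_iff_of_le_of_nonneg_ae hL.le
    (.of_forall fun s => by simpa using hle s) ((by simp : IntervalIntegrable (fun _ => (1:ℝ))
      volume 0 L).sub h_int), Filter.EventuallyEq, ae_restrict_iff' measurableSet_Ioc] at hzero
  filter_upwards [hzero] with s hs hsI
  have := hs (Ioo_subset_Ioc_self hsI)
  simp only [Pi.zero_apply] at this
  linarith

end Minimal

lemma hasDerivAt_norm_of_ne_zero {G : ℝ → E3} {v : E3} {s : ℝ} (hv : HasDerivAt G v s)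
    (hs : G s ≠ 0) : HasDerivAt (fun t => ‖G t‖) (‖G s‖⁻¹ * ⟪G s, v⟫) s := by
  have h1 := hv.norm_sq.sqrt (by simpa using hs)
  simp only [Real.sqrt_sq (norm_nonneg _)] at h1
  exact h1.congr_deriv (by field_simp)

lemma radial_sq_add_angular_sq {G : ℝ → E3} {v : E3} {s : ℝ} (hv : HasDerivAt G v s)
    (hs : G s ≠ 0) : (‖G s‖⁻¹ * ⟪G s, v⟫) ^ 2 +
      ‖G s‖ ^ 2 * ‖deriv (fun t => ‖G t‖⁻¹ • G t) s‖ ^ 2 = ‖v‖ ^ 2 := by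
  have hn : ‖G s‖ ≠ 0 := norm_ne_zero_iff.2 hs
  have h1 := ((hasDerivAt_norm_of_ne_zero hv hs).fun_inv hn).fun_smul hv
  rw [h1.deriv, norm_add_sq_real, norm_smul, norm_smul, inner_smul_left, inner_smul_right,
    real_inner_comm]
  simp only [mul_pow, Real.norm_eq_abs, sq_abs, conj_trivial]
  field_simp
  ring

section Minimal

variable {L : ℝ} {γ : AddCircle L → E3}

lemma IsMinInspectionCurve.projDeriv_eq_zero_near_zero (hγ : IsMinInspectionCurve L γ) {t₀ : ℝ}
    (h0 : liftCurve L γ t₀ = 0) :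
    ∃ r > 0, (∀ s, |s - t₀| ≤ r → ‖liftCurve L γ s‖ = |s - t₀|) ∧
      ∀ s, s ≠ t₀ → |s - t₀| < r → projDeriv L γ s = 0 := by
  obtain ⟨r, hr, v, hv, h⟩ := hγ.exists_eq_smul_near_zero h0
  have hnorm : ∀ s, |s - t₀| ≤ r → ‖liftCurve L γ s‖ = |s - t₀| := fun s hs => by
    rw [h s hs, norm_smul, hv, mul_one, Real.norm_eq_abs]
  refine ⟨r, hr, hnorm, fun s hst hs => ?_⟩
  have hopen : ∀ᶠ u in nhds s, |u - t₀| < r :=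
    (continuous_abs.comp (continuous_id.sub continuous_const)).continuousAt.eventually_lt
      continuousAt_const hs
  unfold projDeriv
  rcases lt_or_gt_of_ne hst with hlt | hgt
  · have : (fun u => ‖liftCurve L γ u‖⁻¹ • liftCurve L γ u) =ᶠ[nhds s] fun _ => -v := by
      filter_upwards [hopen, eventually_lt_nhds hlt] with u hu hu'
      rw [hnorm u hu.le, h u hu.le, smul_smul, abs_of_neg (by linarith), inv_neg, neg_mul,
        inv_mul_cancel₀ (by linarith), neg_one_smul]
    rw [this.deriv_eq, deriv_const]
  · have : (fun u => ‖liftCurve L γ u‖⁻¹ • liftCurve L γ u) =ᶠ[nhds s] fun _ => v := by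
      filter_upwards [hopen, eventually_gt_nhds hgt] with u hu hu'
      rw [hnorm u hu.le, h u hu.le, smul_smul, abs_of_pos (by linarith),
        inv_mul_cancel₀ (by linarith), one_smul]
    rw [this.deriv_eq, deriv_const]

lemma IsMinInspectionCurve.locallyIntegrable_projDeriv (hγ : IsMinInspectionCurve L γ) :
    LocallyIntegrable (fun s => ‖projDeriv L γ s‖) volume := by
  have hGlip : LipschitzWith 1 (liftCurve L γ) := hγ.1.2.2.1
  intro x
  rcases eq_or_ne (liftCurve L γ x) 0 with h0 | h0
  · obtain ⟨r, hr, -, h⟩ := hγ.projDeriv_eq_zero_near_zero h0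
    refine ⟨Metric.ball x r, Metric.ball_mem_nhds x hr, ?_⟩
    refine IntegrableOn.of_bound measure_ball_lt_top
      (measurable_deriv _).norm.aestronglyMeasurable 0 ?_
    rw [ae_restrict_iff' measurableSet_ball]
    filter_upwards [measure_singleton (μ := volume) x |> compl_mem_ae_iff.2] with s hs hsb
    rw [h s hs (by simpa [Real.dist_eq] using hsb)]; simp
  · have hpos : 0 < ‖liftCurve L γ x‖ := norm_pos_iff.2 h0
    set c := ‖liftCurve L γ x‖ / 2 with hc
    have hcpos : 0 < c := half_pos hpos
    refine ⟨Metric.ball x c, Metric.ball_mem_nhds x hcpos, ?_⟩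
    refine IntegrableOn.of_bound measure_ball_lt_top
      (measurable_deriv _).norm.aestronglyMeasurable c⁻¹ ?_
    rw [ae_restrict_iff' measurableSet_ball]
    filter_upwards [hGlip.ae_differentiableAt] with s hs hsb
    have h1 : c ≤ ‖liftCurve L γ s‖ := by
      have h2 := hGlip.dist_le_mul x s
      have h3 := norm_sub_norm_le (liftCurve L γ x) (liftCurve L γ s)
      rw [NNReal.coe_one, one_mul, dist_comm x, dist_eq_norm] at h2
      have h4 := Metric.mem_ball.1 hsb
      linarith
    have h2 := radial_sq_add_angular_sq hs.hasDerivAt (norm_pos_iff.1 (hcpos.trans_le h1))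
    have h3 : ‖deriv (liftCurve L γ) s‖ ≤ 1 := by
      simpa using norm_deriv_le_of_lipschitz (x₀ := s) hGlip
    rw [norm_norm, ← one_div, le_div_iff₀ hcpos]
    change ‖projDeriv L γ s‖ * c ≤ 1
    change _ + _ * ‖projDeriv L γ s‖ ^ 2 = _ at h2
    have h4 : (‖liftCurve L γ s‖ * ‖projDeriv L γ s‖) ^ 2 ≤ 1 := by
      rw [mul_pow]
      nlinarith [sq_nonneg (‖liftCurve L γ s‖⁻¹ * ⟪liftCurve L γ s, deriv (liftCurve L γ) s⟫),
        norm_nonneg (deriv (liftCurve L γ) s)]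
    have h5 := abs_le_of_sq_le_sq' (h4.trans_eq (one_pow 2).symm) zero_le_one
    nlinarith [norm_nonneg (projDeriv L γ s), h5.2]

lemma IsMinInspectionCurve.intervalIntegrable_projDeriv (hγ : IsMinInspectionCurve L γ) (a b : ℝ) :
    IntervalIntegrable (fun s => ‖projDeriv L γ s‖) volume a b :=
  intervalIntegrable_iff.2 ((hγ.locallyIntegrable_projDeriv.integrableOn_isCompact
    isCompact_uIcc).mono_set uIoc_subset_uIcc)

lemma IsMinInspectionCurve.thetaFn_sub (hγ : IsMinInspectionCurve L γ) (a b : ℝ) :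
    thetaFn L γ b - thetaFn L γ a = ∫ u in a..b, ‖projDeriv L γ u‖ :=
  intervalIntegral.integral_interval_sub_left (hγ.intervalIntegrable_projDeriv _ _)
    (hγ.intervalIntegrable_projDeriv _ _)

lemma IsMinInspectionCurve.absolutelyContinuous_thetaFn (hγ : IsMinInspectionCurve L γ)
    (a b : ℝ) : AbsolutelyContinuousOnInterval (thetaFn L γ) a b := by
  have h := (hγ.intervalIntegrable_projDeriv (min 0 (min a b)) (max 0 (max a b))
    ).absolutelyContinuousOnInterval_intervalIntegral (c := 0)
      (mem_uIcc_of_le (min_le_left _ _) (le_max_left _ _))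
  refine h.mono ?_
  rw [uIcc_of_le (a := min 0 _) ((min_le_left _ _).trans (le_max_left _ _))]
  exact Icc_subset_Icc (min_le_right _ _) (le_max_right _ _)

lemma IsMinInspectionCurve.ae_polar (hγ : IsMinInspectionCurve L γ) :
    ∀ᵐ s, s ∈ Ioo 0 L → liftCurve L γ s ≠ 0 → ∃ r, HasDerivAt (fun t => ‖liftCurve L γ t‖) r s ∧
      HasDerivAt (thetaFn L γ) ‖projDeriv L γ s‖ s ∧
      r ^ 2 + ‖liftCurve L γ s‖ ^ 2 * ‖projDeriv L γ s‖ ^ 2 = 1 := by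
  have hGlip : LipschitzWith 1 (liftCurve L γ) := hγ.1.2.2.1
  filter_upwards [hGlip.ae_differentiableAt, hγ.ae_norm_deriv_eq_one,
    LocallyIntegrable.ae_hasDerivAt_integral hγ.locallyIntegrable_projDeriv] with s h1 h2 h3 hs hs0
  refine ⟨_, hasDerivAt_norm_of_ne_zero h1.hasDerivAt hs0, h3 0, ?_⟩
  have := radial_sq_add_angular_sq h1.hasDerivAt hs0
  rw [h2 hs, one_pow] at this
  exact this

end Minimal

/-- Polar coordinates `(ρ, Θ)` of a unit-speed planar arc on `[a, b]` with angular speed `q`,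
strictly increasing distance `ρ` from the origin, `ρ² - t²` concave, initial velocity orthogonal
to the position vector, and straight near the origin. -/
structure IsPolarArc (ρ Θ q : ℝ → ℝ) (a b : ℝ) : Prop where
  lt : a < b
  continuous : Continuous ρ
  nonneg : ∀ s, 0 ≤ ρ s
  strictMonoOn : StrictMonoOn ρ (Icc a b)
  concaveOn : ConcaveOn ℝ (Icc a b) (fun t => ρ t ^ 2 - t ^ 2)
  absolutelyContinuous : AbsolutelyContinuousOnInterval Θ a b
  q_nonneg : ∀ s, 0 ≤ q s
  ae_hasDerivAt : ∀ᵐ s, s ∈ Ioo a b → ∃ r, HasDerivAt ρ r s ∧ HasDerivAt Θ (q s) s ∧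
    r ^ 2 + ρ s ^ 2 * q s ^ 2 = 1
  hasDerivWithinAt_sq : HasDerivWithinAt (fun t => ρ t ^ 2) 0 (Ici a) a
  straight : ρ a = 0 → ∃ r > 0, ∀ s ∈ Icc a (a + r), Θ s = Θ a ∧ ρ s = s - a

/-- The quadratic `ρ(t)² + 2 w (s - t) + (s - t)²` bounds `ρ(s)²` from above on `[a, b]`. -/
def IsUpperParabola (ρ : ℝ → ℝ) (a b t w : ℝ) : Prop :=
  ∀ s ∈ Icc a b, ρ s ^ 2 ≤ ρ t ^ 2 + 2 * w * (s - t) + (s - t) ^ 2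

lemma IsUpperParabola.sq_sub_sq_le {ρ : ℝ → ℝ} {a b t s w w' : ℝ} (hρ0 : ∀ s, 0 ≤ ρ s)
    (hρ : MonotoneOn ρ (Icc a b)) (ht : t ∈ Icc a b) (hs : s ∈ Icc a b) (hts : t < s)
    (hw : 0 ≤ w) (hw' : 0 ≤ w') (h : IsUpperParabola ρ a b t w) (h' : IsUpperParabola ρ a b s w') :
    ρ t ^ 2 - w ^ 2 ≤ ρ s ^ 2 - w' ^ 2 := by
  have h1 := h s hs
  have h2 := h' t ht
  have hΔ : 0 < s - t := by linarith
  have h3 : w' ≤ w + (s - t) := by nlinarith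
  rcases le_or_gt (s - t) w' with hc | hc
  · nlinarith [mul_nonneg (sub_nonneg.2 hc) (sub_nonneg.2 h3)]
  · have hmem : s - w' ∈ Icc a b := ⟨by linarith [ht.1], by linarith [hs.2]⟩
    have h4 := h' _ hmem
    have h5 := pow_le_pow_left₀ (hρ0 t) (hρ ht hmem (by linarith)) 2
    nlinarith [sq_nonneg w]

lemma IsUpperParabola.add_sq_le {ρ : ℝ → ℝ} {a b s u w h : ℝ} (hρ0 : ∀ s, 0 ≤ ρ s)
    (hρ : MonotoneOn ρ (Icc a b)) (hs : s ∈ Icc a b) (hu : u ∈ Icc a b) (hsu : s ≤ u)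
    (hw : 0 ≤ w) (hp : IsUpperParabola ρ a b u w) (hh : ρ u ^ 2 - w ^ 2 ≤ h ^ 2)
    (hsh : h ^ 2 < ρ s ^ 2) :
    h ^ 2 + (√(ρ s ^ 2 - h ^ 2) + (u - s)) ^ 2 ≤ ρ u ^ 2 := by
  set y := √(ρ s ^ 2 - h ^ 2) with hy
  have hy0 : 0 ≤ y := Real.sqrt_nonneg _
  have hy2 : y ^ 2 = ρ s ^ 2 - h ^ 2 := Real.sq_sqrt (by linarith)
  have hmono := pow_le_pow_left₀ (hρ0 s) (hρ hs hu hsu) 2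
  set Y := √(ρ u ^ 2 - h ^ 2) with hY
  have hY0 : 0 ≤ Y := Real.sqrt_nonneg _
  have hY2 : Y ^ 2 = ρ u ^ 2 - h ^ 2 := Real.sq_sqrt (by linarith)
  have hYw : Y ≤ w := by nlinarith
  have hδ : u - s < w := by
    by_contra! hc
    have hmem : u - w ∈ Icc a b := ⟨by linarith [hs.1], by linarith [hu.2]⟩
    have h4 := hp _ hmem
    have h5 := pow_le_pow_left₀ (hρ0 s) (hρ hs hmem (by linarith)) 2
    nlinarith
  have h1 := hp s hs
  have h2 : u - s ≤ Y := by
    by_contra! hc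
    nlinarith
  have h3 : y ≤ Y - (u - s) := by
    have h6 : y ^ 2 ≤ (Y - (u - s)) ^ 2 := by nlinarith
    exact le_of_sq_le_sq h6 (by linarith)
  nlinarith

lemma hasDerivAt_arctan_shift_div {h : ℝ} (hh : 0 < h) (c u : ℝ) :
    HasDerivAt (fun u => arctan ((u + c) / h)) (h / (h ^ 2 + (u + c) ^ 2)) u := by
  have h1 := (((hasDerivAt_id u).add_const c).div_const h).arctan
  refine h1.congr_deriv ?_
  have : h ^ 2 + (u + c) ^ 2 ≠ 0 := by positivity
  have h2 : 1 + ((u + c) / h) ^ 2 ≠ 0 := by positivity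
  simp only [id]
  field_simp

lemma absolutelyContinuousOnInterval_arctan_shift_div (h c a b : ℝ) :
    AbsolutelyContinuousOnInterval (fun u => arctan ((u + c) / h)) a b :=
  ContDiffOn.absolutelyContinuousOnInterval (ContDiff.contDiffOn (ContDiff.arctan (by fun_prop)))

lemma mul_cos_le_of_arctan_le {ρ h x A : ℝ} (hρ0 : 0 ≤ ρ) (hh : 0 < h) (hx : 0 ≤ x)
    (hρ : ρ ^ 2 ≤ h ^ 2 + x ^ 2) (hA : arctan (x / h) ≤ A) (hAπ : A ≤ π) : ρ * cos A ≤ h := by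
  rcases le_or_gt (cos A) 0 with hc | hc
  · nlinarith
  have h0 : 0 ≤ arctan (x / h) := arctan_nonneg.2 (by positivity)
  have h1 : cos A ≤ cos (arctan (x / h)) := cos_le_cos_of_nonneg_of_le_pi h0 hAπ hA
  have h2 : √(h ^ 2 + x ^ 2) * cos (arctan (x / h)) = h := by
    have h3 : h ^ 2 + x ^ 2 = h ^ 2 * (1 + (x / h) ^ 2) := by field_simp
    rw [cos_arctan, h3, Real.sqrt_mul (sq_nonneg h), Real.sqrt_sq hh.le]
    have : √(1 + (x / h) ^ 2) ≠ 0 := by positivity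
    field_simp
  calc ρ * cos A ≤ √(h ^ 2 + x ^ 2) * cos (arctan (x / h)) :=
        mul_le_mul (Real.le_sqrt_of_sq_le hρ) h1 hc.le (Real.sqrt_nonneg _)
    _ = h := h2

namespace IsPolarArc

variable {ρ Θ q : ℝ → ℝ} {a b : ℝ}

lemma isUpperParabola_of_hasDerivAt (H : IsPolarArc ρ Θ q a b) {t r : ℝ} (ht : t ∈ Icc a b)
    (hr : HasDerivAt ρ r t) : IsUpperParabola ρ a b t (ρ t * r) := by
  have hF : HasDerivAt (fun t => ρ t ^ 2 - t ^ 2) (2 * (ρ t * r) - 2 * t) t := by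
    refine ((hr.fun_pow 2).fun_sub ((hasDerivAt_id' t).fun_pow 2)).congr_deriv ?_
    simp; ring
  intro s hs
  rcases lt_trichotomy s t with h | h | h
  · have := H.concaveOn.le_slope_of_hasDerivAt hs ht h hF
    rw [slope_def_field, le_div_iff₀ (by linarith)] at this
    linarith
  · simp [h]
  · have := H.concaveOn.slope_le_of_hasDerivAt ht hs h hF
    rw [slope_def_field, div_le_iff₀ (by linarith)] at this
    linarith

lemma isUpperParabola_left (H : IsPolarArc ρ Θ q a b) : IsUpperParabola ρ a b a 0 := by
  have hF : HasDerivWithinAt (fun t => ρ t ^ 2 - t ^ 2) (0 - 2 * a) (Ioi a) a := by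
    refine ((H.hasDerivWithinAt_sq.mono Ioi_subset_Ici_self).fun_sub
      ((hasDerivAt_id' a).fun_pow 2).hasDerivWithinAt).congr_deriv ?_
    simp
  intro s hs
  rcases hs.1.eq_or_lt with h | h
  · simp [h]
  · have := H.concaveOn.slope_le_of_hasDerivWithinAt_Ioi ⟨le_rfl, H.lt.le⟩ hs h hF
    rw [slope_def_field, div_le_iff₀ (by linarith)] at this
    linarith

lemma ae_parabola (H : IsPolarArc ρ Θ q a b) :
    ∀ᵐ s, s ∈ Ioo a b → ∃ w, 0 ≤ w ∧ w ≤ ρ s ∧ IsUpperParabola ρ a b s w ∧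
      HasDerivAt Θ (q s) s ∧ (ρ s ^ 2 * q s) ^ 2 = ρ s ^ 2 - w ^ 2 := by
  filter_upwards [H.ae_hasDerivAt] with s hs hsI
  obtain ⟨r, hr, hΘ, hq⟩ := hs hsI
  have hr1 : r ≤ 1 := by nlinarith [mul_nonneg (sq_nonneg (ρ s)) (sq_nonneg (q s))]
  have hr0 : 0 ≤ r := by
    have h1 : 0 ≤ derivWithin ρ (Icc a b) s := H.strictMonoOn.monotoneOn.derivWithin_nonneg
    rwa [hr.hasDerivWithinAt.derivWithin (uniqueDiffOn_Icc H.lt s (Ioo_subset_Icc_self hsI))] at h1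
  refine ⟨ρ s * r, mul_nonneg (H.nonneg s) hr0, mul_le_of_le_one_right (H.nonneg s) hr1,
    H.isUpperParabola_of_hasDerivAt (Ioo_subset_Icc_self hsI) hr, hΘ, ?_⟩
  linear_combination (ρ s) ^ 2 * hq

lemma exists_isUpperParabola (H : IsPolarArc ρ Θ q a b) {t : ℝ} (ht : t ∈ Icc a b) :
    ∃ w, 0 ≤ w ∧ w ≤ ρ t ∧ IsUpperParabola ρ a b t w := by
  have hc := H.continuous
  set S : Set (ℝ × ℝ) := (Icc a b ×ˢ Icc 0 (ρ b)) ∩ ({p | p.2 ≤ ρ p.1} ∩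
    ⋂ s ∈ Icc a b, {p | ρ s ^ 2 ≤ ρ p.1 ^ 2 + 2 * p.2 * (s - p.1) + (s - p.1) ^ 2}) with hS
  have hScpt : IsCompact S := by
    refine (isCompact_Icc.prod isCompact_Icc).inter_right (IsClosed.inter ?_ ?_)
    · exact isClosed_le continuous_snd (hc.comp continuous_fst)
    · exact isClosed_biInter fun s _ => isClosed_le continuous_const (by fun_prop)
  have hcl : IsClosed (Prod.fst '' S) := (hScpt.image continuous_fst).isClosed
  have hdense := (Measure.dense_of_ae H.ae_parabola).open_subset_closure_inter
    (isOpen_Ioo (a := a) (b := b))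
  have hsub : Ioo a b ∩ {s | s ∈ Ioo a b → ∃ w, 0 ≤ w ∧ w ≤ ρ s ∧ IsUpperParabola ρ a b s w ∧
      HasDerivAt Θ (q s) s ∧ (ρ s ^ 2 * q s) ^ 2 = ρ s ^ 2 - w ^ 2} ⊆ Prod.fst '' S := by
    rintro s ⟨hs, hs'⟩
    obtain ⟨w, hw0, hw1, hw, -⟩ := hs' hs
    have hsI := Ioo_subset_Icc_self hs
    refine ⟨(s, w), ⟨⟨hsI, hw0, hw1.trans (H.strictMonoOn.monotoneOn hsI
      ⟨H.lt.le, le_rfl⟩ hsI.2)⟩, hw1, ?_⟩, rfl⟩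
    simp only [mem_iInter]
    exact fun s' hs' => hw s' hs'
  have h1 : Icc a b ⊆ Prod.fst '' S := by
    rw [← closure_Ioo H.lt.ne]
    exact closure_minimal (hdense.trans (closure_minimal hsub hcl)) hcl
  obtain ⟨⟨t', w⟩, ⟨⟨-, hw0, -⟩, hw1, hw⟩, rfl⟩ := h1 ht
  simp only [mem_iInter] at hw
  exact ⟨w, hw0, hw1, fun s hs => hw s hs⟩

lemma pos (H : IsPolarArc ρ Θ q a b) {s : ℝ} (hs : s ∈ Ioc a b) : 0 < ρ s :=
  (H.nonneg a).trans_lt (H.strictMonoOn ⟨le_rfl, H.lt.le⟩ ⟨hs.1.le, hs.2⟩ hs.1)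

lemma ac_mono (H : IsPolarArc ρ Θ q a b) {s t : ℝ} (hs : s ∈ Icc a b) (ht : t ∈ Icc a b) :
    AbsolutelyContinuousOnInterval Θ s t := by
  refine H.absolutelyContinuous.mono ?_
  rw [uIcc_of_le H.lt.le]
  exact uIcc_subset_Icc hs ht

lemma monotoneOn_angle (H : IsPolarArc ρ Θ q a b) : MonotoneOn Θ (Icc a b) := by
  intro s hs t ht hst
  refine (H.ac_mono hs ht).le_of_ae_hasDerivAt_nonneg hst ?_
  filter_upwards [H.ae_hasDerivAt] with u hu huI
  obtain ⟨r, -, h, -⟩ := hu ⟨hs.1.trans_lt huI.1, huI.2.trans_le ht.2⟩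
  exact ⟨_, H.q_nonneg u, h⟩

lemma arctan_sub_arctan_le (H : IsPolarArc ρ Θ q a b) {s t w h : ℝ} (ht : t ∈ Icc a b)
    (hs : s ∈ Icc a b) (hts : t ≤ s) (hw : 0 ≤ w) (hp : IsUpperParabola ρ a b t w) (hh : 0 < h)
    (hh2 : h ^ 2 = ρ t ^ 2 - w ^ 2) :
    arctan ((s - t + w) / h) - arctan (w / h) ≤ Θ s - Θ t := by
  have key := ((H.ac_mono ht hs).sub
    (absolutelyContinuousOnInterval_arctan_shift_div h (w - t) t s)).le_of_ae_hasDerivAt_nonneg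
    hts (by
    filter_upwards [H.ae_parabola] with u hu huI
    have huI' : u ∈ Ioo a b := ⟨ht.1.trans_lt huI.1, huI.2.trans_le hs.2⟩
    have huI'' := Ioo_subset_Icc_self huI'
    obtain ⟨wu, hwu0, hwu1, hpu, hΘ, hqu⟩ := hu huI'
    refine ⟨_, ?_, hΘ.sub (hasDerivAt_arctan_shift_div hh (w - t) u)⟩
    have h1 := IsUpperParabola.sq_sub_sq_le H.nonneg H.strictMonoOn.monotoneOn ht huI'' huI.1
      hw hwu0 hp hpu
    have h2 := hp u huI''
    have hρu := H.pos (s := u) ⟨huI'.1, huI'.2.le⟩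
    have h3 : h ≤ ρ u ^ 2 * q u := by
      refine le_of_sq_le_sq ?_ (mul_nonneg (sq_nonneg _) (H.q_nonneg u))
      linarith
    have h4 : ρ u ^ 2 ≤ h ^ 2 + (u + (w - t)) ^ 2 := by rw [hh2]; linarith
    have hq := H.q_nonneg u
    rw [sub_nonneg, div_le_iff₀ (by positivity)]
    nlinarith)
  simp only [Pi.sub_apply] at key
  have e1 : t + (w - t) = w := by ring
  have e2 : s + (w - t) = s - t + w := by ring
  rw [e1, e2] at key
  linarith

lemma le_arctan_sub_arctan (H : IsPolarArc ρ Θ q a b) {s t w h : ℝ} (ht : t ∈ Icc a b)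
    (hs : s ∈ Icc a b) (hst : s ≤ t) (hw : 0 ≤ w) (hp : IsUpperParabola ρ a b t w) (hh : 0 < h)
    (hh2 : h ^ 2 = ρ t ^ 2 - w ^ 2) (hsh : h ^ 2 < ρ s ^ 2) :
    Θ t - Θ s ≤ arctan (w / h) - arctan (√(ρ s ^ 2 - h ^ 2) / h) := by
  set y := √(ρ s ^ 2 - h ^ 2) with hy
  have hy0 : 0 ≤ y := Real.sqrt_nonneg _
  have key := ((absolutelyContinuousOnInterval_arctan_shift_div h (y - s) s t).sub
    (H.ac_mono hs ht)).le_of_ae_hasDerivAt_nonneg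
    hst (by
    filter_upwards [H.ae_parabola] with u hu huI
    have huI' : u ∈ Ioo a b := ⟨hs.1.trans_lt huI.1, huI.2.trans_le ht.2⟩
    have huI'' := Ioo_subset_Icc_self huI'
    obtain ⟨wu, hwu0, hwu1, hpu, hΘ, hqu⟩ := hu huI'
    refine ⟨_, ?_, (hasDerivAt_arctan_shift_div hh (y - s) u).sub hΘ⟩
    have h1 := IsUpperParabola.sq_sub_sq_le H.nonneg H.strictMonoOn.monotoneOn huI'' ht huI.2
      hwu0 hw hpu hp
    have h2 := IsUpperParabola.add_sq_le (h := h) H.nonneg H.strictMonoOn.monotoneOn hs huI''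
      huI.1.le hwu0 hpu (by linarith) hsh
    have h3 : ρ u ^ 2 * q u ≤ h := le_of_sq_le_sq (by linarith) hh.le
    have hq := H.q_nonneg u
    have h4 : h ^ 2 + (u + (y - s)) ^ 2 ≤ ρ u ^ 2 := by
      refine le_trans (le_of_eq ?_) h2
      rw [← hy]; ring
    rw [sub_nonneg, le_div_iff₀ (by positivity)]
    nlinarith)
  simp only [Pi.sub_apply] at key
  have e1 : s + (y - s) = y := by ring
  rw [e1] at key
  have h2 := IsUpperParabola.add_sq_le (h := h) H.nonneg H.strictMonoOn.monotoneOn hs ht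
      hst hw hp hh2.ge hsh
  have h5 : t + (y - s) ≤ w := by
    refine le_of_sq_le_sq ?_ hw
    rw [← hy] at h2
    linarith
  have h6 : arctan ((t + (y - s)) / h) ≤ arctan (w / h) := arctan_strictMono.monotone (by gcongr)
  linarith

end IsPolarArc

lemma re_mul_exp_I (x y : ℝ) : ((x : ℂ) * Complex.exp (Complex.I * (y : ℂ))).re = x * cos y := by
  rw [mul_comm Complex.I, Complex.re_ofReal_mul, Complex.exp_ofReal_mul_I_re]

lemma im_mul_exp_I (x y : ℝ) : ((x : ℂ) * Complex.exp (Complex.I * (y : ℂ))).im = x * sin y := by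
  rw [mul_comm Complex.I, Complex.im_ofReal_mul, Complex.exp_ofReal_mul_I_im]

lemma norm_mul_exp_I {x : ℝ} (hx : 0 ≤ x) (y : ℝ) :
    ‖(x : ℂ) * Complex.exp (Complex.I * (y : ℂ))‖ = x := by
  rw [norm_mul, mul_comm Complex.I, Complex.norm_exp_ofReal_mul_I, mul_one, Complex.norm_real,
    Real.norm_of_nonneg hx]

lemma dot2_cos_sin_mul_exp_I (φ x y : ℝ) :
    dot2 ⟨cos φ, sin φ⟩ ((x : ℂ) * Complex.exp (Complex.I * (y : ℂ))) = x * cos (y - φ) := by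
  rw [dot2, re_mul_exp_I, im_mul_exp_I, cos_sub]; ring

lemma HasDerivWithinAt.mul_exp_I {ρ Θ : ℝ → ℝ} {r p t : ℝ} {s : Set ℝ}
    (hρ : HasDerivWithinAt ρ r s t) (hΘ : HasDerivWithinAt Θ p s t) :
    HasDerivWithinAt (fun u => (ρ u : ℂ) * Complex.exp (Complex.I * (Θ u : ℂ)))
      (((r : ℂ) + Complex.I * ((ρ t * p : ℝ) : ℂ)) * Complex.exp (Complex.I * (Θ t : ℂ))) s t := by
  have h1 := hρ.ofReal_comp.fun_mul ((hΘ.ofReal_comp.const_mul Complex.I).cexp)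
  refine h1.congr_deriv ?_
  push_cast; ring

namespace IsPolarArc

variable {ρ Θ q : ℝ → ℝ} {a b : ℝ}

lemma exists_support_angle (H : IsPolarArc ρ Θ q a b) {t : ℝ} (ht : t ∈ Icc a b) :
    ∃ α ∈ Icc 0 (π / 2), ∀ s ∈ Icc a b, |Θ s - Θ t| ≤ π / 2 →
      ρ s * cos (Θ s - Θ t + α) ≤ ρ t * cos α := by
  obtain ⟨w, hw0, hw1, hp⟩ := H.exists_isUpperParabola ht
  have hmono := H.monotoneOn_angle
  have hsq : 0 ≤ ρ t ^ 2 - w ^ 2 := by nlinarith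
  rcases hsq.eq_or_lt with h0 | hpos
  · refine ⟨π / 2, ⟨by positivity, le_rfl⟩, fun s hs hΘ => ?_⟩
    rw [cos_pi_div_two, mul_zero, cos_add_pi_div_two]
    rcases le_total t s with hts | hst
    · have h1 : 0 ≤ sin (Θ s - Θ t) := sin_nonneg_of_nonneg_of_le_pi
        (sub_nonneg.2 (hmono ht hs hts)) (by linarith [(abs_le.1 hΘ).2, pi_pos])
      nlinarith [H.nonneg s]
    · have h1 : Θ s - Θ t ≥ 0 := by
        have key := (H.ac_mono hs ht).neg.le_of_ae_hasDerivAt_nonneg hst (by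
          filter_upwards [H.ae_parabola] with u hu huI
          have huI' : u ∈ Ioo a b := ⟨hs.1.trans_lt huI.1, huI.2.trans_le ht.2⟩
          obtain ⟨wu, hwu0, hwu1, hpu, hΘu, hqu⟩ := hu huI'
          have h1 := IsUpperParabola.sq_sub_sq_le H.nonneg H.strictMonoOn.monotoneOn
            (Ioo_subset_Icc_self huI') ht huI.2 hwu0 hw0 hpu hp
          have h2 : ρ u ^ 2 * q u = 0 := by
            refine pow_eq_zero_iff two_ne_zero |>.1 (le_antisymm ?_ (sq_nonneg _))
            linarith
          have h3 : q u = 0 :=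
            (mul_eq_zero.1 h2).resolve_left (pow_ne_zero 2 (H.pos ⟨huI'.1, huI'.2.le⟩).ne')
          exact ⟨_, by rw [h3, neg_zero], hΘu.neg⟩)
        simp only [Pi.neg_apply] at key
        linarith
      have h2 : Θ s - Θ t = 0 := le_antisymm (sub_nonpos.2 (hmono hs ht hst)) h1
      rw [h2]; simp
  · set h := √(ρ t ^ 2 - w ^ 2) with hh
    have hh0 : 0 < h := Real.sqrt_pos.2 hpos
    have hh2 : h ^ 2 = ρ t ^ 2 - w ^ 2 := Real.sq_sqrt hsq
    have hα0 : 0 ≤ arctan (w / h) := arctan_nonneg.2 (by positivity)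
    have hα1 : arctan (w / h) ≤ π / 2 := (arctan_lt_pi_div_two _).le
    refine ⟨arctan (w / h), ⟨hα0, hα1⟩, fun s hs hΘ => ?_⟩
    have hval : ρ t * cos (arctan (w / h)) = h := by
      have h3 : ρ t ^ 2 = h ^ 2 * (1 + (w / h) ^ 2) := by field_simp; linarith
      have h4 : ρ t = h * √(1 + (w / h) ^ 2) := by
        rw [← Real.sqrt_sq (H.nonneg t), h3, Real.sqrt_mul (sq_nonneg h), Real.sqrt_sq hh0.le]
      rw [cos_arctan, h4]
      have : √(1 + (w / h) ^ 2) ≠ 0 := by positivity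
      field_simp
    rw [hval]
    rcases le_total t s with hts | hst
    · have h1 := H.arctan_sub_arctan_le ht hs hts hw0 hp hh0 hh2
      refine mul_cos_le_of_arctan_le (x := s - t + w) (H.nonneg s) hh0 (by linarith) ?_
        (by linarith) (by linarith [(abs_le.1 hΘ).2])
      have := hp s hs
      rw [hh2]; linarith
    · rcases le_or_gt (ρ s) h with hle | hgt
      · nlinarith [cos_le_one (Θ s - Θ t + arctan (w / h)), H.nonneg s]
      · have hsh : h ^ 2 < ρ s ^ 2 := pow_lt_pow_left₀ hgt hh0.le two_ne_zero
        have h1 := H.le_arctan_sub_arctan ht hs hst hw0 hp hh0 hh2 hsh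
        refine mul_cos_le_of_arctan_le (x := √(ρ s ^ 2 - h ^ 2)) (H.nonneg s) hh0
          (Real.sqrt_nonneg _) ?_ (by linarith) (by linarith [(abs_le.1 hΘ).2])
        have h2 := Real.sq_sqrt (show 0 ≤ ρ s ^ 2 - h ^ 2 by linarith)
        linarith

lemma hasDerivWithinAt_angle (H : IsPolarArc ρ Θ q a b) (h0 : 0 < ρ a) :
    HasDerivWithinAt Θ (ρ a)⁻¹ (Ici a) a := by
  have ha : a ∈ Icc a b := ⟨le_rfl, H.lt.le⟩
  have hlow : ∀ s ∈ Icc a b, arctan ((s + -a) / ρ a) ≤ Θ s - Θ a := fun s hs => by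
    have := H.arctan_sub_arctan_le ha hs hs.1 le_rfl H.isUpperParabola_left h0 (by ring)
    simpa [sub_eq_add_neg] using this
  have hup : ∀ s ∈ Icc a b, Θ s - Θ a ≤ (s - a) * (ρ a)⁻¹ := fun s hs => by
    have hac : AbsolutelyContinuousOnInterval (fun u => (ρ a)⁻¹ * u) a s :=
      ContDiffOn.absolutelyContinuousOnInterval (ContDiff.contDiffOn (by fun_prop))
    have key := (hac.sub (H.ac_mono ha hs)).le_of_ae_hasDerivAt_nonneg hs.1 (by
      filter_upwards [H.ae_hasDerivAt] with u hu huI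
      have huI' : u ∈ Ioo a b := ⟨huI.1, huI.2.trans_le hs.2⟩
      obtain ⟨r, -, hΘ, hr⟩ := hu huI'
      refine ⟨(ρ a)⁻¹ * 1 - q u, ?_, ((hasDerivAt_id u).const_mul _).sub hΘ⟩
      have h1 : ρ u * q u ≤ 1 := le_of_sq_le_sq (by nlinarith [sq_nonneg r]) zero_le_one
      have h2 := H.strictMonoOn.monotoneOn ha (Ioo_subset_Icc_self huI') huI.1.le
      rw [mul_one, sub_nonneg, ← one_div, le_div_iff₀ h0]
      nlinarith [H.q_nonneg u])
    simp only [Pi.sub_apply] at key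
    linarith
  have hat := (hasDerivAt_arctan_shift_div h0 (-a) a).hasDerivWithinAt (s := Ici a)
  have e : ρ a / (ρ a ^ 2 + (a + -a) ^ 2) = (ρ a)⁻¹ := by rw [add_neg_cancel]; field_simp; simp
  rw [e] at hat
  rw [hasDerivWithinAt_iff_isLittleO] at hat ⊢
  refine Asymptotics.IsBigO.trans_isLittleO (Asymptotics.IsBigO.of_bound 1 ?_) hat
  have hnear : Icc a b ∈ nhdsWithin a (Ici a) := Icc_mem_nhdsGE H.lt
  filter_upwards [hnear] with s hs
  have h1 := hlow s hs
  have h2 := hup s hs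
  simp only [add_neg_cancel, zero_div, arctan_zero, sub_zero, one_mul, smul_eq_mul,
    Real.norm_eq_abs]
  rw [abs_of_nonpos (by linarith), abs_of_nonpos (by linarith)]
  linarith

lemma isStrictSpiral (H : IsPolarArc ρ Θ q a b) {σ : ℝ → ℂ}
    (hσ : ∀ s ∈ Icc a b, σ s = (ρ s : ℂ) * Complex.exp (Complex.I * (Θ s : ℂ))) :
    IsStrictSpiral σ a b := by
  have ha : a ∈ Icc a b := ⟨le_rfl, H.lt.le⟩
  have hΘc : ContinuousOn Θ (Icc a b) := by
    simpa [uIcc_of_le H.lt.le] using H.absolutelyContinuous.continuousOn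
  have hnorm : EqOn (fun s => ‖σ s‖) ρ (Icc a b) := fun s hs => by
    simp only [hσ s hs, norm_mul_exp_I (H.nonneg s)]
  have hstrict : StrictMonoOn (fun s => ‖σ s‖) (Icc a b) := H.strictMonoOn.congr hnorm.symm
  refine ⟨⟨H.lt, ?_, ⟨1, ?_⟩, ⟨fun t ht => ⟨_, self_mem_nhdsWithin, ?_⟩, fun t ht => ?_⟩,
    hstrict.monotoneOn, ?_⟩, hstrict⟩
  · refine ContinuousOn.congr ?_ hσ
    exact (Complex.continuous_ofReal.comp H.continuous).continuousOn.mul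
      (Complex.continuous_exp.comp_continuousOn
        (continuousOn_const.mul (Complex.continuous_ofReal.comp_continuousOn hΘc)))
  · rw [← restrict_Ioo_eq_restrict_Icc, ae_restrict_iff' measurableSet_Ioo]
    filter_upwards [H.ae_hasDerivAt] with s hs hsI
    obtain ⟨r, hr, hΘ, hq⟩ := hs hsI
    have h1 := HasDerivWithinAt.mul_exp_I (hr.hasDerivWithinAt (s := univ))
      (hΘ.hasDerivWithinAt (s := univ))
    rw [hasDerivWithinAt_univ] at h1
    refine ⟨_, h1.congr_of_eventuallyEq ?_, ?_⟩
    · filter_upwards [Icc_mem_nhds hsI.1 hsI.2] with u hu using hσ u hu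
    · rw [norm_mul, mul_comm Complex.I (Θ s : ℂ), Complex.norm_exp_ofReal_mul_I, mul_one,
        mul_comm Complex.I, Complex.norm_add_mul_I, mul_pow, hq, Real.sqrt_one]
  · intro x hx y hy hxy
    exact hstrict.injOn hx hy (by simp only [hxy])
  · obtain ⟨α, hα, hsupp⟩ := H.exists_support_angle ht
    refine ⟨⟨cos (Θ t - α), sin (Θ t - α)⟩, ?_, ?_, {s | s ∈ Icc a b ∧ |Θ s - Θ t| < π / 2}, ?_, ?_⟩
    · intro h
      have h1 := congrArg Complex.re h
      have h2 := congrArg Complex.im h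
      simp only [Complex.zero_re, Complex.zero_im] at h1 h2
      have := sin_sq_add_cos_sq (Θ t - α)
      rw [h1, h2] at this
      norm_num at this
    · rw [hσ t ht, dot2_cos_sin_mul_exp_I, _root_.sub_sub_cancel]
      exact mul_nonneg (H.nonneg t) (cos_nonneg_of_neg_pi_div_two_le_of_le
        (by linarith [hα.1, pi_pos]) hα.2)
    · have h1 : ContinuousWithinAt (fun s => |Θ s - Θ t|) (Icc a b) t :=
        ((hΘc t ht).sub continuousWithinAt_const).abs
      have h2 := h1.eventually_lt continuousWithinAt_const
        (by simpa using pi_div_two_pos : |Θ t - Θ t| < π / 2)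
      filter_upwards [h2, self_mem_nhdsWithin] with s hs hs' using ⟨hs', hs⟩
    · rintro s ⟨hs, hs'⟩
      rw [hσ t ht, hσ s hs, dot2_cos_sin_mul_exp_I, dot2_cos_sin_mul_exp_I, _root_.sub_sub_cancel,
        ← sub_add]
      exact hsupp s hs hs'.le
  · have hnear : Icc a b ∈ nhdsWithin a (Ici a) := Icc_mem_nhdsGE H.lt
    rcases (H.nonneg a).eq_or_lt with h0 | h0
    · obtain ⟨r, hr, hst⟩ := H.straight h0.symm
      refine ⟨Complex.exp (Complex.I * (Θ a : ℂ)), ?_, ?_⟩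
      · have h1 := HasDerivWithinAt.mul_exp_I (ρ := fun s => s - a) (Θ := fun _ => Θ a)
          (((hasDerivAt_id a).sub_const a).hasDerivWithinAt (s := Ici a))
          (hasDerivWithinAt_const a (Ici a) (Θ a))
        simp only [Complex.ofReal_one, mul_zero, Complex.ofReal_zero, add_zero, one_mul] at h1
        refine h1.congr_of_eventuallyEq ?_ ?_
        · filter_upwards [hnear, Icc_mem_nhdsGE (show a < a + r by linarith)] with s hs hs'
          rw [hσ s hs, (hst s hs').1, (hst s hs').2]
        · rw [hσ a ha, ← h0, sub_self]
      · rw [hσ a ha, ← h0]; simp [dot2]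
    · have hρ' : HasDerivWithinAt ρ 0 (Ici a) a := by
        have h1 := H.hasDerivWithinAt_sq.sqrt (by positivity)
        simp only [Real.sqrt_sq (H.nonneg _), zero_div] at h1
        exact h1
      have h1 := HasDerivWithinAt.mul_exp_I hρ' (H.hasDerivWithinAt_angle h0)
      rw [mul_inv_cancel₀ h0.ne'] at h1
      refine ⟨_, h1.congr_of_eventuallyEq ?_ (hσ a ha), ?_⟩
      · filter_upwards [hnear] with s hs using hσ s hs
      · rw [hσ a ha, dot2, re_mul_exp_I, im_mul_exp_I, mul_comm Complex.I (Θ a : ℂ)]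
        simp [Complex.exp_ofReal_mul_I_re, Complex.exp_ofReal_mul_I_im]
        ring

end IsPolarArc

lemma dot2_star_star (x y : ℂ) : dot2 (star x) (star y) = dot2 x y := by
  simp [dot2]

lemma IsStrictSpiral.conj {σ : ℝ → ℂ} {a b : ℝ} (h : IsStrictSpiral σ a b) :
    IsStrictSpiral (fun s => star (σ s)) a b := by
  obtain ⟨⟨hab, hc, ⟨c, hder⟩, ⟨hinj, hsupp⟩, hmono, v, hv, hv0⟩, hstrict⟩ := h
  refine ⟨⟨hab, hc.star, ⟨c, ?_⟩, ⟨fun t ht => ?_, fun t ht => ?_⟩, by simpa using hmono,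
    star v, hv.star, by rw [dot2_star_star, hv0]⟩, by simpa using hstrict⟩
  · filter_upwards [hder] with s hs
    obtain ⟨w, hw, hwc⟩ := hs
    exact ⟨star w, hw.star, by rw [norm_star, hwc]⟩
  · obtain ⟨U, hU, hi⟩ := hinj t ht
    exact ⟨U, hU, fun x hx y hy hxy => hi hx hy (star_injective hxy)⟩
  · obtain ⟨n, hn, hn0, U, hU, hs⟩ := hsupp t ht
    exact ⟨star n, star_ne_zero.2 hn, by rwa [dot2_star_star], U, hU,
      fun s hsU => by simpa only [dot2_star_star] using hs s hsU⟩

section Arcs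

variable {L : ℝ} {γ : AddCircle L → E3} {a b : ℝ}

namespace IsMinInspectionCurve

lemma continuous_norm (hγ : IsMinInspectionCurve L γ) :
    Continuous (fun t => ‖liftCurve L γ t‖) :=
  hγ.1.2.2.1.continuous.norm

lemma thetaFn_eq_near_zero (hγ : IsMinInspectionCurve L γ) {t₀ : ℝ} (h0 : liftCurve L γ t₀ = 0) :
    ∃ r > 0, ∀ s, |s - t₀| ≤ r → thetaFn L γ s = thetaFn L γ t₀ ∧
      ‖liftCurve L γ s‖ = |s - t₀| := by
  obtain ⟨r, hr, h1, h2⟩ := hγ.projDeriv_eq_zero_near_zero h0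
  refine ⟨r / 2, by positivity, fun s hs => ⟨?_, h1 s (by linarith)⟩⟩
  rw [← sub_eq_zero, hγ.thetaFn_sub, intervalIntegral.integral_zero_ae]
  filter_upwards [compl_mem_ae_iff.2 (measure_singleton (μ := volume) t₀)] with u hu huI
  rw [h2 u hu, norm_zero]
  have := abs_sub_left_of_mem_uIcc (uIoc_subset_uIcc huI)
  linarith

lemma isPolarArc (hγ : IsMinInspectionCurve L γ) (ha : 0 ≤ a) (hab : a < b) (hb : b ≤ L)
    (hmono : StrictMonoOn (fun t => ‖liftCurve L γ t‖) (Icc a b))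
    (hd : HasDerivWithinAt (fun t => ‖liftCurve L γ t‖ ^ 2) 0 (Ici a) a) (c : ℝ) :
    IsPolarArc (fun t => ‖liftCurve L γ t‖) (fun t => thetaFn L γ t + c)
      (fun t => ‖projDeriv L γ t‖) a b where
  lt := hab
  continuous := hγ.continuous_norm
  nonneg _ := norm_nonneg _
  strictMonoOn := hmono
  concaveOn := (hγ.concaveOn_norm_sq_sub_sq 0).subset
    (Icc_subset_Icc ha (by linarith)) (convex_Icc a b)
  absolutelyContinuous := (hγ.absolutelyContinuous_thetaFn a b).add
    (ContDiffOn.absolutelyContinuousOnInterval contDiffOn_const)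
  q_nonneg _ := norm_nonneg _
  ae_hasDerivAt := by
    filter_upwards [hγ.ae_polar] with s hs hsI
    have hpos : liftCurve L γ s ≠ 0 := norm_pos_iff.1 ((norm_nonneg _).trans_lt
      (hmono ⟨le_rfl, hab.le⟩ (Ioo_subset_Icc_self hsI) hsI.1))
    obtain ⟨r, h1, h2, h3⟩ := hs ⟨ha.trans_lt hsI.1, hsI.2.trans_le hb⟩ hpos
    exact ⟨r, h1, h2.add_const c, h3⟩
  hasDerivWithinAt_sq := hd
  straight h0 := by
    obtain ⟨r, hr, h⟩ := hγ.thetaFn_eq_near_zero (norm_eq_zero.1 h0)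
    refine ⟨r, hr, fun s hs => ?_⟩
    have h1 : |s - a| = s - a := abs_of_nonneg (by linarith [hs.1])
    obtain ⟨h2, h3⟩ := h s (by rw [h1]; linarith [hs.2])
    exact ⟨by simp only [h2], by simp only [h3, h1]⟩

lemma absolutelyContinuous_thetaFn_reflect (hγ : IsMinInspectionCurve L γ) (c : ℝ) :
    AbsolutelyContinuousOnInterval (fun s => -(thetaFn L γ (a + b - s) + c)) a b := by
  have h_int : IntervalIntegrable (fun u => ‖projDeriv L γ (a + b - u)‖) volume a b := by
    have := (hγ.intervalIntegrable_projDeriv b a).comp_sub_left (a + b)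
    simpa using this
  have h1 := h_int.absolutelyContinuousOnInterval_intervalIntegral (c := a) left_mem_uIcc
  have h2 := h1.add (ContDiffOn.absolutelyContinuousOnInterval
    (contDiffOn_const (c := -(thetaFn L γ b + c))))
  refine (congrArg (AbsolutelyContinuousOnInterval · a b) (funext fun s => ?_)).mpr h2
  rw [Pi.add_apply, intervalIntegral.integral_comp_sub_left (fun u => ‖projDeriv L γ u‖),
    ← hγ.thetaFn_sub, _root_.add_sub_cancel_left]
  ring

lemma isPolarArc_reflect (hγ : IsMinInspectionCurve L γ) (ha : 0 ≤ a) (hab : a < b) (hb : b ≤ L)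
    (hanti : StrictAntiOn (fun t => ‖liftCurve L γ t‖) (Icc a b))
    (hd : HasDerivWithinAt (fun t => ‖liftCurve L γ t‖ ^ 2) 0 (Iic b) b) (c : ℝ) :
    IsPolarArc (fun t => ‖liftCurve L γ (a + b - t)‖) (fun t => -(thetaFn L γ (a + b - t) + c))
      (fun t => ‖projDeriv L γ (a + b - t)‖) a b where
  lt := hab
  continuous := hγ.continuous_norm.comp (by fun_prop)
  nonneg _ := norm_nonneg _
  strictMonoOn := fun x hx y hy hxy => hanti ⟨by linarith [hy.2], by linarith [hy.1]⟩
    ⟨by linarith [hx.2], by linarith [hx.1]⟩ (by linarith)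
  concaveOn := by
    have h := (hγ.concaveOn_norm_sq_sub_sq 0).subset
      (Icc_subset_Icc ha (by linarith)) (convex_Icc a b)
    refine ⟨convex_Icc a b, fun x hx y hy p r hp hr hpr => ?_⟩
    have h1 := h.2 (x := a + b - x) ⟨by linarith [hx.2], by linarith [hx.1]⟩
      (y := a + b - y) ⟨by linarith [hy.2], by linarith [hy.1]⟩ hp hr hpr
    simp only [smul_eq_mul] at h1 ⊢
    have e : p * (a + b - x) + r * (a + b - y) = a + b - (p * x + r * y) := by
      linear_combination (a + b) * hpr
    rw [e] at h1
    obtain rfl : r = 1 - p := by linarith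
    linarith
  absolutelyContinuous := hγ.absolutelyContinuous_thetaFn_reflect c
  q_nonneg _ := norm_nonneg _
  ae_hasDerivAt := by
    have hae := (Measure.measurePreserving_sub_left volume
      (a + b)).quasiMeasurePreserving.ae hγ.ae_polar
    filter_upwards [hae] with s hs hsI
    have hsI' : a + b - s ∈ Ioo a b := ⟨by linarith [hsI.2], by linarith [hsI.1]⟩
    have hpos : liftCurve L γ (a + b - s) ≠ 0 := norm_pos_iff.1 ((norm_nonneg _).trans_lt
      (hanti (Ioo_subset_Icc_self hsI') ⟨hab.le, le_rfl⟩ hsI'.2))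
    obtain ⟨r, h1, h2, h3⟩ := hs ⟨ha.trans_lt hsI'.1, hsI'.2.trans_le hb⟩ hpos
    have h4 : HasDerivAt (fun u => a + b - u) (-1) s := (hasDerivAt_id s).const_sub _
    refine ⟨r * -1, HasDerivAt.comp s h1 h4, ?_, by linarith⟩
    have h5 := ((HasDerivAt.comp s h2 h4).add_const c).neg
    rw [mul_neg_one, neg_neg] at h5
    exact h5
  hasDerivWithinAt_sq := by
    have h4 : HasDerivWithinAt (fun u => a + b - u) (-1) (Ici a) a :=
      ((hasDerivAt_id a).const_sub _).hasDerivWithinAt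
    have h5 : HasDerivWithinAt (fun t => ‖liftCurve L γ t‖ ^ 2) 0 (Iic b) (a + b - a) := by
      rwa [_root_.add_sub_cancel_left]
    have h6 := HasDerivWithinAt.comp a h5 h4 (fun u hu => by
      rw [mem_Ici] at hu; rw [mem_Iic]; linarith)
    rw [zero_mul] at h6
    exact h6
  straight h0 := by
    rw [_root_.add_sub_cancel_left] at h0
    obtain ⟨r, hr, h⟩ := hγ.thetaFn_eq_near_zero (norm_eq_zero.1 h0)
    refine ⟨r, hr, fun s hs => ?_⟩
    have h1 : |a + b - s - b| = s - a := by
      rw [abs_of_nonpos (by linarith [hs.1])]; ring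
    obtain ⟨h2, h3⟩ := h (a + b - s) (by rw [h1]; linarith [hs.2])
    exact ⟨by simp only [h2, _root_.add_sub_cancel_left], by simp only [h3, h1]⟩

end IsMinInspectionCurve

end Arcs

lemma StrictMonoOn.Icc_union_Icc_of_le {f : ℝ → ℝ} {a b c d : ℝ} (h₁ : StrictMonoOn f (Icc a b))
    (h₂ : StrictMonoOn f (Icc c d)) (hcb : c ≤ b) : StrictMonoOn f (Icc a d) := by
  intro x hx y hy hxy
  rcases le_or_gt y b with hyb | hyb
  · exact h₁ ⟨hx.1, hxy.le.trans hyb⟩ ⟨hy.1, hyb⟩ hxy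
  · rcases le_or_gt c x with hcx | hcx
    · exact h₂ ⟨hcx, hx.2⟩ ⟨hcx.trans hxy.le, hy.2⟩ hxy
    · exact (h₁ ⟨hx.1, hcx.le.trans hcb⟩ ⟨hx.1.trans (hcx.le.trans hcb), le_rfl⟩
        (hcx.trans_le hcb)).trans (h₂ ⟨hcb, hyb.le.trans hy.2⟩ ⟨hcb.trans hyb.le, hy.2⟩ hyb)

lemma exists_leftmost_strictMonoOn {f : ℝ → ℝ} (hf : Continuous f) {m c d : ℝ} (hmc : m ≤ c)
    (h : StrictMonoOn f (Icc c d)) :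
    ∃ a ∈ Icc m c, StrictMonoOn f (Icc a d) ∧
      ∀ x ∈ Icc m c, StrictMonoOn f (Icc x d) → a ≤ x := by
  set A := {x | x ∈ Icc m c ∧ StrictMonoOn f (Icc x d)} with hA
  have hne : A.Nonempty := ⟨c, ⟨hmc, le_rfl⟩, h⟩
  have hbdd : BddBelow A := ⟨m, fun x hx => hx.1.1⟩
  have hac : sInf A ≤ c := csInf_le hbdd ⟨⟨hmc, le_rfl⟩, h⟩
  have hIoc : StrictMonoOn f (Ioc (sInf A) d) := fun x hx y hy hxy => by
    obtain ⟨u, hu, hux⟩ := exists_lt_of_csInf_lt hne hx.1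
    exact hu.2 ⟨hux.le, hx.2⟩ ⟨hux.le.trans hxy.le, hy.2⟩ hxy
  refine ⟨sInf A, ⟨le_csInf hne fun x hx => hx.1.1, hac⟩, fun x hx y hy hxy => ?_,
    fun x hx hx' => csInf_le hbdd ⟨hx, hx'⟩⟩
  rcases hx.1.eq_or_lt with rfl | hlt
  · obtain ⟨z, hz1, hz2⟩ := exists_between hxy
    refine lt_of_le_of_lt ?_ (hIoc ⟨hz1, hz2.le.trans hy.2⟩ ⟨hxy, hy.2⟩ hz2)
    refine le_of_tendsto (hf.continuousWithinAt (s := Ioi (sInf A))) ?_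
    filter_upwards [Ioo_mem_nhdsGT hz1] with u hu
    exact (hIoc ⟨hu.1, (hu.2.trans hz2).le.trans hy.2⟩ ⟨hz1, hz2.le.trans hy.2⟩ hu.2).le
  · exact hIoc ⟨hlt, hx.2⟩ ⟨hlt.trans hxy, hy.2⟩ hxy

lemma strictMonoOn_neg_comp_neg {f : ℝ → ℝ} {a b : ℝ} (h : StrictMonoOn f (Icc a b)) :
    StrictMonoOn (fun t => -f (-t)) (Icc (-b) (-a)) := fun x hx y hy hxy =>
  neg_lt_neg (h ⟨by linarith [hy.2], by linarith [hy.1]⟩ ⟨by linarith [hx.2], by linarith [hx.1]⟩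
    (neg_lt_neg hxy))

/-- `[a, b]` is a maximal nondegenerate subinterval of `[0, L]` on which `f` is strictly
increasing. -/
structure IsMaximalStrictMonoInterval (f : ℝ → ℝ) (L a b : ℝ) : Prop where
  lt : a < b
  nonneg : 0 ≤ a
  le : b ≤ L
  strictMonoOn : StrictMonoOn f (Icc a b)
  eq_of_le : ∀ c d, 0 ≤ c → d ≤ L → c ≤ a → b ≤ d → StrictMonoOn f (Icc c d) → c = a ∧ d = b

lemma exists_isMaximalStrictMonoInterval {f : ℝ → ℝ} (hf : Continuous f) {L c d : ℝ} (hc : 0 ≤ c)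
    (hcd : c < d) (hd : d ≤ L) (h : StrictMonoOn f (Icc c d)) :
    ∃ a b, IsMaximalStrictMonoInterval f L a b ∧ Icc c d ⊆ Icc a b := by
  obtain ⟨a, ha, hamono, hamin⟩ := exists_leftmost_strictMonoOn hf hc h
  obtain ⟨b', hb, hbmono, hbmin⟩ := exists_leftmost_strictMonoOn
    (f := fun t => -f (-t)) (by fun_prop) (neg_le_neg hd)
    (strictMonoOn_neg_comp_neg hamono)
  have hb1 : d ≤ -b' := by linarith [hb.2]
  have hmono : StrictMonoOn f (Icc a (-b')) := by
    simpa using strictMonoOn_neg_comp_neg hbmono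
  refine ⟨a, -b', ⟨by linarith [ha.2], ha.1, by linarith [hb.1], hmono, ?_⟩,
    Icc_subset_Icc ha.2 hb1⟩
  intro x y hx hy hxa hby hxy
  have h1 : x = a := le_antisymm hxa (hamin x ⟨hx, hxa.trans ha.2⟩
    (hxy.mono (Icc_subset_Icc_right (hb1.trans hby))))
  subst h1
  exact ⟨rfl, le_antisymm (by
    linarith [hbmin (-y) ⟨by linarith, by linarith⟩ (strictMonoOn_neg_comp_neg hxy)]) hby⟩

namespace IsMaximalStrictMonoInterval

variable {f : ℝ → ℝ} {L a b c d : ℝ}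

lemma eq_of_overlap (h₁ : IsMaximalStrictMonoInterval f L a b)
    (h₂ : IsMaximalStrictMonoInterval f L c d) (hcb : c < b) (had : a < d) : a = c ∧ b = d := by
  have aux : ∀ {a b c d : ℝ}, IsMaximalStrictMonoInterval f L a b →
      IsMaximalStrictMonoInterval f L c d → c < b → a < d → a ≤ c → a = c ∧ b = d := by
    intro a b c d h₁ h₂ hcb had hac
    rcases le_total b d with hbd | hbd
    · have hU := h₁.strictMonoOn.Icc_union_Icc_of_le h₂.strictMonoOn hcb.le
      exact ⟨(h₂.eq_of_le a d h₁.nonneg h₂.le hac le_rfl hU).1,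
        (h₁.eq_of_le a d h₁.nonneg h₂.le le_rfl hbd hU).2.symm⟩
    · exact h₂.eq_of_le a b h₁.nonneg h₁.le hac hbd h₁.strictMonoOn
  rcases le_total a c with hac | hca
  · exact aux h₁ h₂ hcb had hac
  · obtain ⟨h1, h2⟩ := aux h₂ h₁ had hcb hca
    exact ⟨h1.symm, h2.symm⟩

lemma not_overlap_neg (h₁ : IsMaximalStrictMonoInterval f L a b)
    (h₂ : IsMaximalStrictMonoInterval (fun t => -f t) L c d) (hcb : c < b) (had : a < d) :
    False := by
  obtain ⟨x, hx1, hx2⟩ := exists_between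
    (show max a c < min b d from max_lt (lt_min h₁.lt had) (lt_min hcb h₂.lt))
  obtain ⟨y, hy1, hy2⟩ := exists_between hx2
  rw [max_lt_iff] at hx1
  rw [lt_min_iff] at hy2
  have h3 := h₁.strictMonoOn ⟨hx1.1.le, (hy1.trans hy2.1).le⟩
    ⟨(hx1.1.trans hy1).le, hy2.1.le⟩ hy1
  have h4 := h₂.strictMonoOn ⟨hx1.2.le, (hy1.trans hy2.2).le⟩
    ⟨(hx1.2.trans hy1).le, hy2.2.le⟩ hy1
  linarith

end IsMaximalStrictMonoInterval

lemma ConcaveOn.exists_rightDeriv_sub_sq {G : ℝ → ℝ} {s η : ℝ} (hη : 0 < η)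
    (hG : ConcaveOn ℝ (Icc (s - η) (s + η)) (fun t => G t - t ^ 2)) :
    ∃ d, HasDerivWithinAt G d (Ici s) s ∧
      (0 < d → ∃ δ > 0, StrictMonoOn G (Icc (s - δ) s)) := by
  have hs : s ∈ interior (Icc (s - η) (s + η)) := by
    rw [interior_Icc]; exact ⟨by linarith, by linarith⟩
  have h1 := (hG.neg.hasDerivWithinAt_rightDeriv_of_mem_interior hs).Ici_of_Ioi
  set e := derivWithin (-fun t => G t - t ^ 2) (Ioi s) s with he
  have h2 : HasDerivWithinAt G (-e + 2 * s) (Ici s) s := by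
    have h3 := h1.neg.add ((hasDerivAt_pow 2 s).hasDerivWithinAt (s := Ici s))
    refine (h3.congr_deriv (by simp)).congr (fun x _ => ?_) ?_ <;> simp
  refine ⟨_, h2, fun hd => ?_⟩
  set d := -e + 2 * s with hd'
  have key : ∀ x y, s - η ≤ x → x < y → y ≤ s →
      (-e) * (y - x) ≤ (G y - y ^ 2) - (G x - x ^ 2) := by
    intro x y hx hxy hys
    have hy : y ∈ interior (Icc (s - η) (s + η)) := by
      rw [interior_Icc]; exact ⟨by linarith, by linarith⟩
    have h3 : slope (-fun t => G t - t ^ 2) x y ≤ e :=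
      (hG.neg.slope_le_leftDeriv_of_mem_interior ⟨hx, by linarith⟩ hy hxy).trans
      ((hG.neg.leftDeriv_le_rightDeriv_of_mem_interior hy).trans
        (hG.neg.monotoneOn_rightDeriv hy hs hys))
    rw [slope_def_field, div_le_iff₀ (by linarith)] at h3
    simp only [Pi.neg_apply] at h3
    linarith
  refine ⟨min η (d / 4), lt_min hη (by positivity), fun x hx y hy hxy => ?_⟩
  have h4 := key x y (by linarith [hx.1, min_le_left η (d / 4)]) hxy hy.2
  have h5 := min_le_right η (d / 4)
  have h6 : 0 < (y - x) * (d - (s - x) - (s - y)) :=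
    mul_pos (by linarith) (by linarith [hx.1, hy.1])
  nlinarith

lemma ConcaveOn.exists_leftDeriv_sub_sq {G : ℝ → ℝ} {s η : ℝ} (hη : 0 < η)
    (hG : ConcaveOn ℝ (Icc (s - η) (s + η)) (fun t => G t - t ^ 2)) :
    ∃ d, HasDerivWithinAt G d (Iic s) s ∧
      (d < 0 → ∃ δ > 0, StrictAntiOn G (Icc s (s + δ))) := by
  have hG' : ConcaveOn ℝ (Icc (-s - η) (-s + η)) (fun t => G (-t) - t ^ 2) := by
    refine ⟨convex_Icc _ _, fun x hx y hy p r hp hr hpr => ?_⟩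
    have h1 := hG.2 (x := -x) ⟨by linarith [hx.2], by linarith [hx.1]⟩
      (y := -y) ⟨by linarith [hy.2], by linarith [hy.1]⟩ hp hr hpr
    simp only [smul_eq_mul, mul_neg, ← neg_add, neg_sq] at h1 ⊢
    exact h1
  obtain ⟨d, hd, hmono⟩ := ConcaveOn.exists_rightDeriv_sub_sq (G := fun t => G (-t)) hη hG'
  refine ⟨-d, ?_, fun hneg => ?_⟩
  · have h1 := HasDerivWithinAt.comp s hd ((hasDerivAt_neg s).hasDerivWithinAt (s := Iic s))
      (fun u hu => mem_Ici.2 (neg_le_neg (mem_Iic.1 hu)))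
    refine (h1.congr_deriv (by ring)).congr (fun x _ => ?_) ?_ <;> simp
  · obtain ⟨δ, hδ, h⟩ := hmono (by linarith)
    refine ⟨δ, hδ, fun x hx y hy hxy => ?_⟩
    have h1 := h (a := -y) ⟨by linarith [hy.2], by linarith [hy.1]⟩
      (b := -x) ⟨by linarith [hx.2], by linarith [hx.1]⟩ (neg_lt_neg hxy)
    simpa using h1

section Assembly

variable {L : ℝ} {γ : AddCircle L → E3} {γt : ℝ → ℂ} {a b : ℝ}

lemma IsUnfolding.exists_phase (h : IsUnfolding L γ γt) (ha : 0 ≤ a) (hab : a < b) (hb : b ≤ L)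
    (hne : ∀ s ∈ Ioo a b, liftCurve L γ s ≠ 0) :
    ∃ c : ℝ, ∀ s ∈ Icc a b, γt s = (‖liftCurve L γ s‖ : ℂ) *
      Complex.exp (Complex.I * ((thetaFn L γ s + c : ℝ) : ℂ)) := by
  obtain ⟨m, tk, -, -, h0, hm, hzero, hγt⟩ := h
  have hex : ∃ k, a < tk k := ⟨m, by rw [hm]; exact hab.trans_le hb⟩
  classical
  set k := Nat.find hex with hk
  have hak : a < tk k := Nat.find_spec hex
  have hk1 : 1 ≤ k := by
    by_contra! hlt
    rw [Nat.lt_one_iff.1 hlt, h0] at hak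
    linarith
  have hkm : k ≤ m := Nat.find_min' hex (by rw [hm]; exact hab.trans_le hb)
  have hka : tk (k - 1) ≤ a := not_lt.1 (Nat.find_min hex (Nat.sub_lt hk1 one_pos))
  have hbk : b ≤ tk k := by
    by_contra! hlt
    have hkm' : k < m := lt_of_le_of_ne hkm (by rintro h; rw [h, hm] at hlt; linarith)
    exact hne (tk k) ⟨hak, hlt⟩ ((hzero (tk k) ⟨ha.trans_lt hak, hlt.trans_le hb⟩).2
      ⟨k, hk1, hkm', rfl⟩)
  exact ⟨((k : ℝ) - 1) * π, fun s hs => hγt k hk1 hkm s ⟨hka.trans hs.1, hs.2.trans hbk⟩⟩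

lemma IsUnfolding.norm_eq (h : IsUnfolding L γ γt) {s : ℝ} (hs : s ∈ Ico 0 L) :
    ‖γt s‖ = ‖liftCurve L γ s‖ := by
  obtain ⟨m, tk, -, -, h0, hm, -, hγt⟩ := h
  have hex : ∃ k, s < tk k := ⟨m, by rw [hm]; exact hs.2⟩
  classical
  have hsk := Nat.find_spec hex
  have hk1 : 1 ≤ Nat.find hex := by
    by_contra! hlt
    rw [Nat.lt_one_iff.1 hlt, h0] at hsk
    linarith [hs.1]
  rw [hγt _ hk1 (Nat.find_min' hex (by rw [hm]; exact hs.2)) s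
    ⟨not_lt.1 (Nat.find_min hex (Nat.sub_lt hk1 one_pos)), hsk.le⟩]
  exact norm_mul_exp_I (norm_nonneg _) _

lemma strictMonoOn_of_sq {f : ℝ → ℝ} (hf : ∀ s, 0 ≤ f s) {S : Set ℝ}
    (h : StrictMonoOn (fun s => f s ^ 2) S) : StrictMonoOn f S := fun _ hx y hy hxy =>
  lt_of_pow_lt_pow_left₀ 2 (hf y) (h hx hy hxy)

lemma strictAntiOn_of_sq {f : ℝ → ℝ} (hf : ∀ s, 0 ≤ f s) {S : Set ℝ}
    (h : StrictAntiOn (fun s => f s ^ 2) S) : StrictAntiOn f S := fun x hx _ hy hxy =>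
  lt_of_pow_lt_pow_left₀ 2 (hf x) (h hx hy hxy)

namespace IsMinInspectionCurve

lemma concaveOn_centered (hγ : IsMinInspectionCurve L γ) (s : ℝ) :
    ConcaveOn ℝ (Icc (s - L / 2) (s + L / 2)) (fun t => ‖liftCurve L γ t‖ ^ 2 - t ^ 2) := by
  have h := hγ.concaveOn_norm_sq_sub_sq (s - L / 2)
  rwa [show s - L / 2 + L = s + L / 2 by ring] at h

lemma exists_rightDeriv (hγ : IsMinInspectionCurve L γ) (s : ℝ) :
    ∃ d, HasDerivWithinAt (fun t => ‖liftCurve L γ t‖ ^ 2) d (Ici s) s ∧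
      (0 < d → ∃ δ > 0, StrictMonoOn (fun t => ‖liftCurve L γ t‖) (Icc (s - δ) s)) := by
  obtain ⟨d, h1, h2⟩ := (hγ.concaveOn_centered s).exists_rightDeriv_sub_sq (half_pos hγ.1.1)
  refine ⟨d, h1, fun hd => ?_⟩
  obtain ⟨δ, hδ, h3⟩ := h2 hd
  exact ⟨δ, hδ, strictMonoOn_of_sq (fun _ => norm_nonneg _) h3⟩

lemma exists_leftDeriv (hγ : IsMinInspectionCurve L γ) (s : ℝ) :
    ∃ d, HasDerivWithinAt (fun t => ‖liftCurve L γ t‖ ^ 2) d (Iic s) s ∧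
      (d < 0 → ∃ δ > 0, StrictAntiOn (fun t => ‖liftCurve L γ t‖) (Icc s (s + δ))) := by
  obtain ⟨d, h1, h2⟩ := (hγ.concaveOn_centered s).exists_leftDeriv_sub_sq (half_pos hγ.1.1)
  refine ⟨d, h1, fun hd => ?_⟩
  obtain ⟨δ, hδ, h3⟩ := h2 hd
  exact ⟨δ, hδ, strictAntiOn_of_sq (fun _ => norm_nonneg _) h3⟩

lemma hasDerivWithinAt_left_endpoint (hγ : IsMinInspectionCurve L γ)
    (h0 : IsLocalMin (fun s : ℝ => ‖liftCurve L γ s‖) 0)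
    (h : IsMaximalStrictMonoInterval (fun t => ‖liftCurve L γ t‖) L a b) :
    HasDerivWithinAt (fun t => ‖liftCurve L γ t‖ ^ 2) 0 (Ici a) a := by
  obtain ⟨d, hd, hmono⟩ := hγ.exists_rightDeriv a
  have hd0 : 0 ≤ d := by
    refine ge_of_tendsto (hasDerivWithinAt_iff_tendsto_slope' self_notMem_Ioi |>.1 hd.Ioi_of_Ici) ?_
    filter_upwards [Ioo_mem_nhdsGT h.lt] with x hx
    have h1 := h.strictMonoOn ⟨le_rfl, h.lt.le⟩ ⟨hx.1.le, hx.2.le⟩ hx.1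
    have h2 := pow_le_pow_left₀ (norm_nonneg _) h1.le 2
    rw [slope_def_field]
    exact div_nonneg (sub_nonneg.2 h2) (by linarith [hx.1])
  rcases hd0.eq_or_lt with rfl | hpos
  · exact hd
  obtain ⟨δ, hδ, hm⟩ := hmono hpos
  exfalso
  rcases h.nonneg.eq_or_lt with rfl | ha
  · obtain ⟨x, hx1, hx2⟩ := ((h0.filter_mono nhdsWithin_le_nhds).and
      (Ioo_mem_nhdsLT (show 0 - δ < 0 by linarith))).exists
    exact absurd (hm ⟨hx2.1.le, hx2.2.le⟩ ⟨by linarith, le_rfl⟩ hx2.2) (not_lt.2 hx1)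
  · have h1 := (hm.mono (Icc_subset_Icc_left (show a - δ ≤ a - min δ a by
      linarith [min_le_left δ a]))).Icc_union_Icc_of_le h.strictMonoOn le_rfl
    have h2 := (h.eq_of_le _ _ (by linarith [min_le_right δ a]) h.le
      (by linarith [lt_min hδ ha]) le_rfl h1).1
    linarith [lt_min hδ ha]

lemma hasDerivWithinAt_right_endpoint (hγ : IsMinInspectionCurve L γ)
    (h0 : IsLocalMin (fun s : ℝ => ‖liftCurve L γ s‖) 0)
    (h : IsMaximalStrictMonoInterval (fun t => -‖liftCurve L γ t‖) L a b) :
    HasDerivWithinAt (fun t => ‖liftCurve L γ t‖ ^ 2) 0 (Iic b) b := by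
  obtain ⟨d, hd, hmono⟩ := hγ.exists_leftDeriv b
  have hd0 : d ≤ 0 := by
    refine le_of_tendsto (hasDerivWithinAt_iff_tendsto_slope' self_notMem_Iio |>.1 hd.Iio_of_Iic) ?_
    filter_upwards [Ioo_mem_nhdsLT h.lt] with x hx
    have h1 := neg_lt_neg_iff.1 (h.strictMonoOn ⟨hx.1.le, hx.2.le⟩ ⟨h.lt.le, le_rfl⟩ hx.2)
    have h2 := pow_le_pow_left₀ (norm_nonneg _) h1.le 2
    rw [slope_def_field]
    exact div_nonpos_of_nonneg_of_nonpos (sub_nonneg.2 h2) (by linarith [hx.2])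
  rcases hd0.eq_or_lt with rfl | hneg
  · exact hd
  obtain ⟨δ, hδ, hm⟩ := hmono hneg
  exfalso
  rcases h.le.eq_or_lt with rfl | hb
  · have hper := liftCurve_periodic b γ
    obtain ⟨x, hx1, hx2⟩ := ((h0.filter_mono nhdsWithin_le_nhds).and (Ioo_mem_nhdsGT hδ)).exists
    have h1 := hm (a := b) ⟨le_rfl, by linarith⟩ (b := x + b)
      ⟨by linarith [hx2.1], by linarith [hx2.2]⟩ (by linarith [hx2.1])
    simp only [hper x] at h1
    have h2 := hper 0
    rw [zero_add] at h2
    rw [h2] at h1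
    exact absurd h1 (not_lt.2 hx1)
  · have h1 := h.strictMonoOn.Icc_union_Icc_of_le (hm.mono (Icc_subset_Icc_right
      (show b + min δ (L - b) ≤ b + δ by linarith [min_le_left δ (L - b)]))).neg le_rfl
    have h3 := lt_min hδ (sub_pos.2 hb)
    have h2 := (h.eq_of_le _ _ h.nonneg (by linarith [min_le_right δ (L - b)]) le_rfl
      (by linarith) h1).2
    linarith

lemma deriv_norm_eq_zero (hγ : IsMinInspectionCurve L γ) {s : ℝ} (hs : s ∈ Ioo 0 L)
    (hd : DifferentiableAt ℝ (fun t => ‖liftCurve L γ t‖) s)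
    (hup : ∀ a b, IsMaximalStrictMonoInterval (fun t => ‖liftCurve L γ t‖) L a b → s ∉ Icc a b)
    (hdown : ∀ a b, IsMaximalStrictMonoInterval (fun t => -‖liftCurve L γ t‖) L a b →
      s ∉ Icc a b) : deriv (fun t => ‖liftCurve L γ t‖) s = 0 := by
  by_contra hne
  have hpos : 0 < ‖liftCurve L γ s‖ := by
    refine lt_of_le_of_ne (norm_nonneg _) fun h => hne (IsLocalMin.deriv_eq_zero ?_)
    exact Filter.Eventually.of_forall fun t => by simp only [← h, norm_nonneg]
  have hsq : HasDerivAt (fun t => ‖liftCurve L γ t‖ ^ 2)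
      (2 * ‖liftCurve L γ s‖ * deriv (fun t => ‖liftCurve L γ t‖) s) s :=
    (hd.hasDerivAt.fun_pow 2).congr_deriv (by simp)
  have h2pos : 0 < 2 * ‖liftCurve L γ s‖ := mul_pos two_pos hpos
  rcases lt_or_gt_of_ne hne with hlt | hgt
  · obtain ⟨d, h1, h2⟩ := hγ.exists_leftDeriv s
    have h3 := (uniqueDiffWithinAt_Iic s).eq_deriv _ h1 hsq.hasDerivWithinAt
    obtain ⟨δ, hδ, hm⟩ := h2 (h3 ▸ mul_neg_of_pos_of_neg h2pos hlt)
    have h4 := lt_min hδ (sub_pos.2 hs.2)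
    obtain ⟨a, b, h, hsub⟩ := exists_isMaximalStrictMonoInterval (L := L) hγ.continuous_norm.neg
      hs.1.le (show s < s + min δ (L - s) by linarith) (by linarith [min_le_right δ (L - s)])
      (hm.mono (Icc_subset_Icc_right (by linarith [min_le_left δ (L - s)]))).neg
    exact hdown a b h (hsub ⟨le_rfl, by linarith⟩)
  · obtain ⟨d, h1, h2⟩ := hγ.exists_rightDeriv s
    have h3 := (uniqueDiffWithinAt_Ici s).eq_deriv _ h1 hsq.hasDerivWithinAt
    obtain ⟨δ, hδ, hm⟩ := h2 (h3 ▸ mul_pos h2pos hgt)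
    have h4 := lt_min hδ hs.1
    obtain ⟨a, b, h, hsub⟩ := exists_isMaximalStrictMonoInterval (L := L) hγ.continuous_norm
      (show 0 ≤ s - min δ s by linarith [min_le_right δ s]) (by linarith) hs.2.le
      (hm.mono (Icc_subset_Icc_left (by linarith [min_le_left δ s])))
    exact hup a b h (hsub ⟨by linarith, le_rfl⟩)

end IsMinInspectionCurve

end Assembly

/-- The unfolding `γt` of a minimal inspection curve `γ` (parameterized
so that `0` is a local minimum point of `|γ|`) admits a spiral decomposition. -/
theorem unfolding_spiral_decomposition
    (L : ℝ) (γ : AddCircle L → E3) (hγ : IsMinInspectionCurve L γ)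
    (h0 : IsLocalMin (fun s : ℝ => ‖liftCurve L γ s‖) 0)
    (γt : ℝ → ℂ) (hunf : IsUnfolding L γ γt) :
    ∃ (ι : Type) (U : ι → Set ℝ), IsSpiralDecomp L γt ι U := by
  set ρ : ℝ → ℝ := fun t => ‖liftCurve L γ t‖ with hρ
  have hρc : Continuous ρ := hγ.continuous_norm
  let P : ℝ × ℝ → Prop := fun p => IsMaximalStrictMonoInterval ρ L p.1 p.2 ∨
    IsMaximalStrictMonoInterval (fun t => -ρ t) L p.1 p.2
  have hlt : ∀ p, P p → p.1 < p.2 ∧ 0 ≤ p.1 ∧ p.2 ≤ L := by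
    rintro p (h | h) <;> exact ⟨h.lt, h.nonneg, h.le⟩
  have hcl : ∀ p : {p // P p}, closure (Ioo p.1.1 p.1.2) = Icc p.1.1 p.1.2 := fun p =>
    closure_Ioo (hlt _ p.2).1.ne
  have hdisj : Pairwise (Function.onFun Disjoint fun p : {p // P p} => Ioo p.1.1 p.1.2) := by
    intro p p' hne
    refine disjoint_left.2 fun x hx hx' => hne (Subtype.ext (Prod.ext_iff.2 ?_))
    have h1 := hx'.1.trans hx.2
    have h2 := hx.1.trans hx'.2
    rcases p.2 with h | h <;> rcases p'.2 with h' | h'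
    · exact h.eq_of_overlap h' h1 h2
    · exact (h.not_overlap_neg h' h1 h2).elim
    · exact (h'.not_overlap_neg h h2 h1).elim
    · exact h.eq_of_overlap h' h1 h2
  refine ⟨{p // P p}, fun p => Ioo p.1.1 p.1.2, hdisj, fun p => ?_, fun p => ?_, ?_⟩
  · refine ⟨Ioo p.1.1 p.1.2, isOpen_Ioo, (inter_eq_left.2 ?_).symm⟩
    exact Ioo_subset_Icc_self.trans (Icc_subset_Icc (hlt _ p.2).2.1 (hlt _ p.2).2.2)
  · refine ⟨p.1.1, p.1.2, hcl p, ?_⟩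
    rcases p.2 with h | h
    · left
      obtain ⟨c, hc⟩ := hunf.exists_phase h.nonneg h.lt h.le fun s hs => norm_pos_iff.1
        ((norm_nonneg _).trans_lt (h.strictMonoOn ⟨le_rfl, h.lt.le⟩ ⟨hs.1.le, hs.2.le⟩ hs.1))
      exact (hγ.isPolarArc h.nonneg h.lt h.le h.strictMonoOn
        (hγ.hasDerivWithinAt_left_endpoint h0 h) c).isStrictSpiral hc
    · right
      have hanti : StrictAntiOn ρ (Icc p.1.1 p.1.2) := fun x hx y hy hxy =>
        neg_lt_neg_iff.1 (h.strictMonoOn hx hy hxy)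
      obtain ⟨c, hc⟩ := hunf.exists_phase h.nonneg h.lt h.le fun s hs => norm_pos_iff.1
        ((norm_nonneg _).trans_lt (hanti ⟨hs.1.le, hs.2.le⟩ ⟨h.lt.le, le_rfl⟩ hs.2))
      have harc := hγ.isPolarArc_reflect h.nonneg h.lt h.le hanti
        (hγ.hasDerivWithinAt_right_endpoint h0 h) c
      have hsp := (harc.isStrictSpiral (σ := fun s => star (γt (p.1.1 + p.1.2 - s)))
        fun s hs => ?_).conj
      · simpa only [star_star] using hsp
      · simp only [hc (p.1.1 + p.1.2 - s) ⟨by linarith [hs.2], by linarith [hs.1]⟩]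
        simp only [Complex.star_def, map_mul, ← Complex.exp_conj, Complex.conj_ofReal,
          Complex.conj_I, Complex.ofReal_neg, mul_neg, neg_mul]
  · have : Countable {p // P p} := hdisj.countable_of_isOpen_disjoint (fun _ => isOpen_Ioo)
      fun p => nonempty_Ioo.2 (hlt _ p.2).1
    have hmeas : MeasurableSet (Icc 0 L \ ⋃ p : {p // P p}, closure (Ioo p.1.1 p.1.2)) :=
      measurableSet_Icc.diff (MeasurableSet.iUnion fun _ => isClosed_closure.measurableSet)
    rw [ae_restrict_iff' hmeas]
    have hρlip : LipschitzWith 1 ρ := by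
      have h := lipschitzWith_one_norm.comp hγ.1.2.2.1
      rwa [one_mul] at h
    filter_upwards [hρlip.ae_differentiableAt, compl_mem_ae_iff.2 (measure_singleton (0 : ℝ)),
      compl_mem_ae_iff.2 (measure_singleton L)] with s hs hs0 hsL hsI
    have hsI' : s ∈ Ioo 0 L :=
      ⟨lt_of_le_of_ne hsI.1.1 (Ne.symm hs0), lt_of_le_of_ne hsI.1.2 hsL⟩
    have hnot : ∀ p, P p → s ∉ Icc p.1 p.2 := fun p hp hsp =>
      hsI.2 (mem_iUnion.2 ⟨⟨p, hp⟩, by rwa [hcl]⟩)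
    have hderiv : deriv ρ s = 0 := hγ.deriv_norm_eq_zero hsI' hs
      (fun a b h => hnot (a, b) (Or.inl h)) (fun a b h => hnot (a, b) (Or.inr h))
    refine (hderiv ▸ hs.hasDerivAt).congr_of_eventuallyEq ?_
    filter_upwards [Ioo_mem_nhds hsI'.1 hsI'.2] with u hu
    exact hunf.norm_eq ⟨hu.1.le, hu.2⟩
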